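/- arXiv:0807.1649 — 4 statements merged into one kernel-verified Lean document; each statement's English description precedes it below -/
import Mathlib

section
/- Let F be a cumulative distribution function and suppose there exist sequences a_N ∈ ℝ and b_N > 0 such that F(a_N + b_N x)^N converges, at every continuity point, to a non-degenerate cumulative distribution function H(x) as N → ∞. Then there exist constants A > 0, B ∈ ℝ and γ ∈ ℝ such that H(A x + B) = H_γ(x), where H_γ(x) = exp(−(1+γx)^{−1/γ}) on {x : 1+γx > 0} (extended by its limiting values 0 or 1 outside this set), and H_0(x) = exp(−e^{−x}). Equivalently, H is, up to a shift and dilatation of the variable, either a Fréchet distribution H_{f,μ}(x) = exp(−x^{−μ}) for x>0 (and 0 for x≤0), a Weibull distribution H_{w,μ}(x) = exp(−(−x)^μ) for x<0 (and 1 for x≥0), or the Gumbel distribution H_g(x) = exp(−e^{−x}), with μ = 1/γ when γ>0 and μ = −1/γ when γ<0. -/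
open MeasureTheory Filter

/-- A cumulative distribution function: monotone, right-continuous, with limits 0 at `-∞`
and 1 at `+∞`. -/
def IsCDF (F : ℝ → ℝ) : Prop :=
  Monotone F ∧ (∀ x, ContinuousWithinAt F (Set.Ici x) x) ∧
    Tendsto F atBot (nhds 0) ∧ Tendsto F atTop (nhds 1)

/-- A degenerate CDF: the distribution function of a constant. -/
def IsDegenerateCDF (F : ℝ → ℝ) : Prop :=
  ∃ c : ℝ, ∀ x : ℝ, F x = if c ≤ x then 1 else 0

/-- The von Mises one-parameter family of extreme value distributions:
`H_γ(x) = exp(−(1+γx)^{−1/γ})` where `1+γx > 0` (extended by its limiting values 0 or 1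
outside this set), and `H_0(x) = exp(−e^{−x})` (Gumbel).  For `γ > 0` this is the Fréchet
family, for `γ < 0` the Weibull family. -/
noncomputable def vonMisesCDF (γ x : ℝ) : ℝ :=
  if γ = 0 then Real.exp (-Real.exp (-x))
  else if 0 < 1 + γ * x then Real.exp (-(1 + γ * x) ^ (-1 / γ))
  else if 0 < γ then 0 else 1

open Real Topology

/-- The standard Gumbel distribution function. -/
noncomputable def gumbelCDF (s : ℝ) : ℝ := exp (-exp (-s))

theorem gumbelCDF_strictMono : StrictMono gumbelCDF := fun x y h => by
  unfold gumbelCDF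
  gcongr

theorem gumbelCDF_continuous : Continuous gumbelCDF := by
  unfold gumbelCDF
  fun_prop

theorem gumbelCDF_pos (s : ℝ) : 0 < gumbelCDF s := exp_pos _

theorem gumbelCDF_lt_one (s : ℝ) : gumbelCDF s < 1 := by
  simp [gumbelCDF, exp_pos]

theorem exists_gumbelCDF_eq {p : ℝ} (h₀ : 0 < p) (h₁ : p < 1) : ∃ s, gumbelCDF s = p := by
  have h : 0 < -log p := neg_pos.2 (log_neg h₀ h₁)
  exact ⟨-log (-log p), by
    rw [gumbelCDF, neg_neg, exp_log h, neg_neg, exp_log h₀]⟩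

theorem gumbelCDF_add_log_pow (s : ℝ) {n : ℕ} (hn : 0 < n) :
    gumbelCDF (s + log n) ^ n = gumbelCDF s := by
  have hn' : (0 : ℝ) < n := by exact_mod_cast hn
  rw [gumbelCDF, gumbelCDF, ← exp_nat_mul, neg_add, exp_add, exp_neg (log n), exp_log hn']
  congr 1
  field_simp

theorem IsCDF.nonneg {F : ℝ → ℝ} (hF : IsCDF F) (x : ℝ) : 0 ≤ F x :=
  hF.1.le_of_tendsto hF.2.2.1 x

theorem IsCDF.le_one {F : ℝ → ℝ} (hF : IsCDF F) (x : ℝ) : F x ≤ 1 :=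
  hF.1.ge_of_tendsto hF.2.2.2 x

/-- `ψ` is the quantile function of `F`, in the probability coordinate given by the Gumbel
distribution function. -/
def IsGumbelQuantile (F ψ : ℝ → ℝ) : Prop :=
  ∀ s x, ψ s ≤ x ↔ gumbelCDF s ≤ F x

theorem IsCDF.exists_isGumbelQuantile {F : ℝ → ℝ} (hF : IsCDF F) :
    ∃ ψ, IsGumbelQuantile F ψ := by
  refine ⟨fun s => sInf {x | gumbelCDF s ≤ F x}, fun s x => ?_⟩
  obtain ⟨y, hy⟩ := (hF.2.2.1.eventually (gt_mem_nhds (gumbelCDF_pos s))).exists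
  obtain ⟨z, hz⟩ := (hF.2.2.2.eventually (lt_mem_nhds (gumbelCDF_lt_one s))).exists
  have hbdd : BddBelow {x | gumbelCDF s ≤ F x} :=
    ⟨y, fun w hw => le_of_lt (hF.1.reflect_lt (hy.trans_le hw))⟩
  refine ⟨fun h => ?_, fun h => csInf_le hbdd h⟩
  have hright : Tendsto F (𝓝[>] x) (𝓝 (F x)) :=
    (hF.2.1 x).mono_left (nhdsWithin_mono _ Set.Ioi_subset_Ici_self)
  refine ge_of_tendsto hright ?_
  filter_upwards [self_mem_nhdsWithin] with w hw
  obtain ⟨v, hv, hvw⟩ := exists_lt_of_csInf_lt ⟨z, hz.le⟩ (h.trans_lt hw)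
  exact le_trans hv (hF.1 hvw.le)

namespace IsGumbelQuantile

variable {F H φ ψ : ℝ → ℝ}

theorem lt_iff (h : IsGumbelQuantile F ψ) (s x : ℝ) : x < ψ s ↔ F x < gumbelCDF s := by
  rw [← not_le, h s x, not_le]

theorem monotone (h : IsGumbelQuantile F ψ) : Monotone ψ := fun s t hst =>
  (h s _).2 ((gumbelCDF_strictMono.monotone hst).trans ((h t _).1 le_rfl))

theorem tendsto_left (h : IsGumbelQuantile F ψ) (s : ℝ) :
    Tendsto ψ (𝓝[<] s) (𝓝 (ψ s)) := by
  rw [tendsto_order]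
  refine ⟨fun x hx => ?_, fun x hx => ?_⟩
  · have := gumbelCDF_continuous.continuousAt.eventually (lt_mem_nhds ((h.lt_iff s x).1 hx))
    filter_upwards [this.filter_mono nhdsWithin_le_nhds] with t ht
    exact (h.lt_iff t x).2 ht
  · filter_upwards [self_mem_nhdsWithin] with t ht
    exact (h.monotone (le_of_lt ht)).trans_lt hx

theorem isDegenerateCDF_of_const (hF : IsCDF F) (h : IsGumbelQuantile F ψ)
    {c : ℝ} (hc : ∀ s, ψ s = c) : IsDegenerateCDF F := by
  refine ⟨c, fun x => ?_⟩
  split_ifs with hx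
  · refine le_antisymm (hF.le_one x) (le_of_forall_lt_imp_le_of_dense fun p hp => ?_)
    rcases le_or_gt p 0 with hp₀ | hp₀
    · exact hp₀.trans (hF.nonneg x)
    · obtain ⟨s, rfl⟩ := exists_gumbelCDF_eq hp₀ hp
      exact (h s x).1 ((hc s).trans_le hx)
  · refine le_antisymm (le_of_not_gt fun hpos => ?_) (hF.nonneg x)
    obtain ⟨p, hp₀, hp⟩ := exists_between hpos
    obtain ⟨s, rfl⟩ := exists_gumbelCDF_eq hp₀ (hp.trans_le (hF.le_one x))
    exact hx ((hc s).symm.trans_le ((h s x).2 hp.le))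

/-- The distribution function is determined by its quantile function. -/
theorem cdf_eq_of_forall_iff (hF : IsCDF F) {x y : ℝ} (h : IsGumbelQuantile F ψ)
    (hy₀ : 0 ≤ y) (hy₁ : y ≤ 1) (hxy : ∀ s, ψ s ≤ x ↔ gumbelCDF s ≤ y) : F x = y := by
  refine le_antisymm (le_of_forall_lt_imp_le_of_dense fun p hp => ?_)
    (le_of_forall_lt_imp_le_of_dense fun p hp => ?_)
  · rcases le_or_gt p 0 with hp₀ | hp₀
    · exact hp₀.trans hy₀
    · obtain ⟨s, rfl⟩ := exists_gumbelCDF_eq hp₀ (hp.trans_le (hF.le_one x))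
      exact (hxy s).1 ((h s x).2 hp.le)
  · rcases le_or_gt p 0 with hp₀ | hp₀
    · exact hp₀.trans (hF.nonneg x)
    · obtain ⟨s, rfl⟩ := exists_gumbelCDF_eq hp₀ (hp.trans_le hy₁)
      exact (h s x).1 ((hxy s).2 hp.le)

/-- The quantile function of the rescaled maximum of `n` independent variables. -/
theorem rescaled_pow (hF : IsCDF F) (h : IsGumbelQuantile F φ) {n : ℕ} (hn : 0 < n)
    (a : ℝ) {b : ℝ} (hb : 0 < b) :
    IsGumbelQuantile (fun x => F (a + b * x) ^ n) (fun s => (φ (s + log n) - a) / b) := by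
  intro s x
  dsimp only
  rw [div_le_iff₀ hb, sub_le_iff_le_add, show x * b + a = a + b * x by ring, h,
    ← gumbelCDF_add_log_pow s hn,
    pow_le_pow_iff_left₀ (gumbelCDF_pos _).le (hF.nonneg _) hn.ne']

/-- Convergence of distribution functions implies convergence of quantile functions. -/
theorem tendsto {ι : Type*} {l : Filter ι} {G Q : ι → ℝ → ℝ} (hH : Monotone H)
    (hψ : IsGumbelQuantile H ψ) (hQ : ∀ᶠ n in l, IsGumbelQuantile (G n) (Q n))
    (hconv : ∀ x, ContinuousAt H x → Tendsto (fun n => G n x) l (𝓝 (H x)))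
    {s : ℝ} (hs : ContinuousAt ψ s) : Tendsto (fun n => Q n s) l (𝓝 (ψ s)) := by
  have hdense : Dense {x | ContinuousAt H x} := by
    simpa [Set.compl_ofPred] using hH.countable_not_continuousAt.dense_compl ℝ
  rw [tendsto_order]
  refine ⟨fun x hx => ?_, fun x hx => ?_⟩
  · obtain ⟨y, hy, hxy, hys⟩ := hdense.exists_between hx
    filter_upwards [hQ, (hconv y hy).eventually (gt_mem_nhds ((hψ.lt_iff s y).1 hys))]
      with n hn hlt
    exact hxy.trans ((hn.lt_iff s y).2 hlt)
  · obtain ⟨t, htx, hst⟩ := (((hs.eventually (gt_mem_nhds hx)).filter_mono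
      nhdsWithin_le_nhds).and (self_mem_nhdsWithin (s := Set.Ioi s))).exists
    obtain ⟨y, hy, hty, hyx⟩ := hdense.exists_between htx
    have hlt : gumbelCDF s < H y :=
      (gumbelCDF_strictMono hst).trans_le ((hψ t y).1 hty.le)
    filter_upwards [hQ, (hconv y hy).eventually (lt_mem_nhds hlt)] with n hn hlt
    exact ((hn s y).2 hlt.le).trans_lt hyx

end IsGumbelQuantile

/-- The increments of `ψ` over any pair of intervals keep their ratio under translation
by `u`. -/
def IncrementsProportional (ψ : ℝ → ℝ) (u : ℝ) : Prop :=
  ∀ r s t, (ψ r - ψ s) * (ψ (t + u) - ψ (s + u)) = (ψ (r + u) - ψ (s + u)) * (ψ t - ψ s)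

theorem incrementsProportional_log_sub_log {φ ψ : ℝ → ℝ} (hmono : Monotone ψ)
    (hleft : ∀ s, Tendsto ψ (𝓝[<] s) (𝓝 (ψ s))) {a b : ℕ → ℝ}
    (hconv : ∀ s, ContinuousAt ψ s →
      Tendsto (fun n : ℕ => (φ (s + log n) - a n) / b n) atTop (𝓝 (ψ s)))
    {m k : ℕ} (hm : 0 < m) (hk : 0 < k) :
    IncrementsProportional ψ (log m - log k) := by
  have hincr : ∀ {j : ℕ}, 0 < j → ∀ {s t : ℝ}, ContinuousAt ψ s → ContinuousAt ψ t →
      Tendsto (fun n : ℕ => (φ (s + log j + log n) - φ (t + log j + log n)) / b (n * j))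
        atTop (𝓝 (ψ s - ψ t)) := by
    intro j hj s t hs ht
    have hsub : Tendsto (fun n : ℕ => n * j) atTop atTop :=
      tendsto_id.atTop_mul_const' hj
    refine (((hconv s hs).comp hsub).sub ((hconv t ht).comp hsub)).congr' ?_
    filter_upwards [eventually_gt_atTop 0] with n hn
    have hn' : (n : ℝ) ≠ 0 := by positivity
    have hj' : (j : ℝ) ≠ 0 := by positivity
    simp only [Function.comp_apply, Nat.cast_mul, log_mul hn' hj', ← sub_div,
      sub_sub_sub_cancel_right, add_assoc, add_comm (log n)]
  set u := log m - log k with hu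
  have hcont : ∀ r s t, ContinuousAt ψ r → ContinuousAt ψ s → ContinuousAt ψ t →
      ContinuousAt ψ (r + u) → ContinuousAt ψ (s + u) → ContinuousAt ψ (t + u) →
      (ψ r - ψ s) * (ψ (t + u) - ψ (s + u)) = (ψ (r + u) - ψ (s + u)) * (ψ t - ψ s) := by
    intro r s t hr hs ht hr' hs' ht'
    refine tendsto_nhds_unique ((hincr hm hr hs).mul (hincr hk ht' hs'))
      (((hincr hk hr' hs').mul (hincr hm ht hs)).congr fun n => ?_)
    have hmk : ∀ x, x + u + log k = x + log m := fun x => by rw [hu]; ring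
    simp only [hmk]
    ring
  intro r s t
  have hlim : ∀ x, Tendsto (fun δ => ψ (x - δ)) (𝓝[>] 0) (𝓝 (ψ x)) := by
    intro x
    refine (hleft x).comp (tendsto_nhdsWithin_iff.2 ⟨?_, ?_⟩)
    · refine Tendsto.mono_left ?_ nhdsWithin_le_nhds
      have hcont : Continuous fun δ : ℝ => x - δ := by fun_prop
      simpa using hcont.tendsto 0
    · filter_upwards [self_mem_nhdsWithin] with δ hδ
      simpa using hδ
  have hcountable : ∀ x, {δ | ¬ ContinuousAt ψ (x - δ)}.Countable := fun x =>
    hmono.countable_not_continuousAt.preimage sub_right_injective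
  have hdense := ((((((hcountable r).union (hcountable s)).union (hcountable t)).union
    (hcountable (r + u))).union (hcountable (s + u))).union (hcountable (t + u))).dense_compl ℝ
  have hfreq : ∃ᶠ δ in 𝓝[>] (0 : ℝ),
      (ψ (r - δ) - ψ (s - δ)) * (ψ (t + u - δ) - ψ (s + u - δ)) -
        (ψ (r + u - δ) - ψ (s + u - δ)) * (ψ (t - δ) - ψ (s - δ)) ∈ ({0} : Set ℝ) := by
    rw [(nhdsGT_basis (0 : ℝ)).frequently_iff]
    intro ε hε
    obtain ⟨δ, hδ, hδε⟩ := hdense.exists_between hε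
    refine ⟨δ, hδε, ?_⟩
    simp only [Set.mem_compl_iff, Set.mem_union, Set.mem_ofPred_eq, not_or, not_not] at hδ
    obtain ⟨⟨⟨⟨⟨h₁, h₂⟩, h₃⟩, h₄⟩, h₅⟩, h₆⟩ := hδ
    have hcomm : ∀ x, x + u - δ = x - δ + u := fun x => by ring
    simp only [hcomm] at h₄ h₅ h₆ ⊢
    exact sub_eq_zero.2 (hcont _ _ _ h₁ h₂ h₃ h₄ h₅ h₆)
  exact sub_eq_zero.1 (isClosed_singleton.mem_of_frequently_of_tendsto hfreq
    ((((hlim r).sub (hlim s)).mul ((hlim (t + u)).sub (hlim (s + u)))).sub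
      (((hlim (r + u)).sub (hlim (s + u))).mul ((hlim t).sub (hlim s)))))

theorem incrementsProportional_of_log_sub_log {ψ : ℝ → ℝ}
    (hleft : ∀ s, Tendsto ψ (𝓝[<] s) (𝓝 (ψ s)))
    (h : ∀ m k : ℕ, 0 < m → 0 < k → IncrementsProportional ψ (log m - log k)) (u : ℝ) :
    IncrementsProportional ψ u := by
  intro r s t
  have hlim : ∀ x, Tendsto (fun v => ψ (x + v)) (𝓝[<] u) (𝓝 (ψ (x + u))) := by
    intro x
    refine (hleft (x + u)).comp (tendsto_nhdsWithin_iff.2 ⟨?_, ?_⟩)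
    · exact (continuous_const.add continuous_id : Continuous fun v : ℝ => x + v).tendsto u
        |>.mono_left nhdsWithin_le_nhds
    · filter_upwards [self_mem_nhdsWithin] with v hv
      simpa using hv
  have hfreq : ∃ᶠ v in 𝓝[<] u,
      (ψ r - ψ s) * (ψ (t + v) - ψ (s + v)) -
        (ψ (r + v) - ψ (s + v)) * (ψ t - ψ s) ∈ ({0} : Set ℝ) := by
    rw [(nhdsLT_basis u).frequently_iff]
    intro l hl
    obtain ⟨q, hlq, hqu⟩ := exists_rat_btwn (exp_lt_exp.2 hl)
    have hq : (0 : ℝ) < q := (exp_pos l).trans hlq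
    have hq₀ : 0 < q := by exact_mod_cast hq
    have hnum : 0 < q.num.natAbs := Int.natAbs_pos.2 (Rat.num_pos.2 hq₀).ne'
    have hlog : log (q.num.natAbs : ℕ) - log (q.den : ℕ) = log q := by
      rw [← log_div (by positivity) (by have := q.den_pos; positivity)]
      congr 1
      conv_rhs => rw [Rat.cast_def]
      congr 1
      rw [Nat.cast_natAbs, abs_of_pos (Rat.num_pos.2 hq₀)]
    refine ⟨log q, ⟨(lt_log_iff_exp_lt hq).2 hlq, (log_lt_iff_lt_exp hq).2 hqu⟩, ?_⟩
    exact sub_eq_zero.2 (hlog ▸ h _ _ hnum q.den_pos r s t)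
  exact sub_eq_zero.1 (isClosed_singleton.mem_of_frequently_of_tendsto hfreq
    ((tendsto_const_nhds.mul ((hlim t).sub (hlim s))).sub
      (((hlim r).sub (hlim s)).mul tendsto_const_nhds)))

theorem eq_mul_of_continuous_of_add {f : ℝ → ℝ} (hf : Continuous f)
    (hadd : ∀ x y, f (x + y) = f x + f y) (x : ℝ) : f x = f 1 * x := by
  have h := ((AddMonoidHom.mk' f hadd).toRealLinearMap hf).map_smul x 1
  rw [smul_eq_mul, mul_one, smul_eq_mul, mul_comm] at h
  exact h

/-- A monotone non-constant function whose translates are affine images of itself is affine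
or an affine image of an exponential. -/
theorem exists_eq_of_incrementsProportional {ψ : ℝ → ℝ} (hmono : Monotone ψ)
    (hnc : ¬ ∃ c, ∀ s, ψ s = c) (h : ∀ u, IncrementsProportional ψ u) :
    ∃ A : ℝ, 0 < A ∧ ∃ B γ : ℝ,
      ∀ s, ψ s = A * (if γ = 0 then s else (exp (γ * s) - 1) / γ) + B := by
  obtain ⟨s₁, s₂, hs⟩ : ∃ s₁ s₂, ψ s₁ < ψ s₂ := by
    by_contra! hle
    exact hnc ⟨ψ 0, fun s => le_antisymm (hle _ _) (hle _ _)⟩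
  have hd : 0 < ψ s₂ - ψ s₁ := sub_pos.2 hs
  set α : ℝ → ℝ := fun u => (ψ (s₂ + u) - ψ (s₁ + u)) / (ψ s₂ - ψ s₁) with hα
  have hincr : ∀ s t u, ψ (s + u) - ψ (t + u) = α u * (ψ s - ψ t) := by
    intro s t u
    have hs' := h u s s₁ s₂
    have ht' := h u t s₁ s₂
    rw [hα]
    field_simp
    linarith
  have hα_pos : ∀ u, 0 < α u := by
    intro u
    refine lt_of_le_of_ne ?_ fun h₀ => hnc ⟨ψ 0, fun s => ?_⟩
    · exact div_nonneg (sub_nonneg.2 (hmono (by linarith [hmono.reflect_lt hs]))) hd.le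
    · have := hincr (s - u) (0 - u) u
      rw [← h₀, zero_mul, sub_add_cancel, sub_add_cancel] at this
      linarith
  have hα_add : ∀ u v, α (u + v) = α u * α v := by
    intro u v
    have h₁ := hincr s₂ s₁ (u + v)
    have h₂ := hincr (s₂ + u) (s₁ + u) v
    rw [hincr s₂ s₁ u, add_assoc, add_assoc, h₁] at h₂
    exact mul_right_cancel₀ hd.ne' (h₂.trans (by ring))
  have hψ_cont : Continuous ψ := by
    obtain ⟨s₀, hs₀⟩ := (hmono.countable_not_continuousAt.dense_compl ℝ).nonempty
    rw [Set.mem_compl_iff, Set.mem_ofPred_eq, not_not] at hs₀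
    rw [continuous_iff_continuousAt]
    intro t
    have heq : ψ = fun s => α (t - s₀) * (ψ (s - (t - s₀)) - ψ s₀) + ψ t := by
      funext s
      have := hincr (s - (t - s₀)) s₀ (t - s₀)
      rw [sub_add_cancel, add_sub_cancel] at this
      linarith
    have hshift : ContinuousAt (fun s => ψ (s - (t - s₀))) t :=
      ContinuousAt.comp (g := ψ) (by simpa using hs₀) (by fun_prop)
    rw [heq]
    exact ((hshift.sub continuousAt_const).const_mul _).add continuousAt_const
  have hα_cont : Continuous α := by
    rw [hα]
    fun_prop
  have hα_exp : ∀ u, α u = exp (log (α 1) * u) := by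
    intro u
    rw [← eq_mul_of_continuous_of_add (hα_cont.log fun u => (hα_pos u).ne')
      (fun x y => by rw [hα_add, log_mul (hα_pos x).ne' (hα_pos y).ne']) u, exp_log (hα_pos u)]
  set γ := log (α 1) with hγ
  have hg : ∀ s u, ψ (s + u) - ψ 0 = exp (γ * u) * (ψ s - ψ 0) + (ψ u - ψ 0) := by
    intro s u
    have := hincr s 0 u
    rw [zero_add, hα_exp] at this
    linarith
  obtain ⟨A, hA⟩ : ∃ A : ℝ, ∀ s,
      ψ s = A * (if γ = 0 then s else (exp (γ * s) - 1) / γ) + ψ 0 := by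
    by_cases h₀ : γ = 0
    · refine ⟨ψ 1 - ψ 0, fun s => ?_⟩
      rw [if_pos h₀]
      have := eq_mul_of_continuous_of_add (f := fun s => ψ s - ψ 0) (by fun_prop)
        (fun x y => by simpa [h₀] using hg x y) s
      linarith
    · have hne : exp γ - 1 ≠ 0 := sub_ne_zero.2 (by simpa using h₀)
      refine ⟨γ * (ψ 1 - ψ 0) / (exp γ - 1), fun s => ?_⟩
      rw [if_neg h₀]
      have h₁ := hg s 1
      have h₂ := hg 1 s
      rw [add_comm 1 s] at h₂
      rw [mul_one] at h₁
      field_simp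
      linarith
  refine ⟨A, ?_, ψ 0, γ, hA⟩
  have hlt : (if γ = 0 then s₁ else (exp (γ * s₁) - 1) / γ) <
      (if γ = 0 then s₂ else (exp (γ * s₂) - 1) / γ) := by
    have hs' := hmono.reflect_lt hs
    split_ifs with h₀
    · exact hs'
    · rcases lt_or_gt_of_ne h₀ with h₀ | h₀
      · rw [div_lt_div_right_of_neg h₀]
        exact sub_lt_sub_right (exp_lt_exp.2 (mul_lt_mul_of_neg_left hs' h₀)) 1
      · gcongr
  rw [hA s₁, hA s₂] at hs
  by_contra! hA₀
  nlinarith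

theorem vonMisesCDF_nonneg (γ x : ℝ) : 0 ≤ vonMisesCDF γ x := by
  unfold vonMisesCDF
  split_ifs <;> positivity

theorem vonMisesCDF_le_one (γ x : ℝ) : vonMisesCDF γ x ≤ 1 := by
  unfold vonMisesCDF
  split_ifs with _ h
  · simpa using (exp_pos _).le
  · simpa using (rpow_pos_of_pos h _).le
  · exact zero_le_one
  · exact le_rfl

theorem gumbelCDF_le_vonMisesCDF_iff (γ s x : ℝ) :
    gumbelCDF s ≤ vonMisesCDF γ x ↔ (if γ = 0 then s else (exp (γ * s) - 1) / γ) ≤ x := by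
  unfold vonMisesCDF
  split_ifs with h₀ h₁ h₂
  · exact gumbelCDF_strictMono.le_iff_le
  · have hexp : (1 + γ * x) ^ (-1 / γ) = exp (-(log (1 + γ * x) / γ)) := by
      rw [rpow_def_of_pos h₁]
      congr 1
      ring
    rw [hexp]
    change gumbelCDF s ≤ gumbelCDF (log (1 + γ * x) / γ) ↔ _
    rw [gumbelCDF_strictMono.le_iff_le]
    rcases lt_or_gt_of_ne h₀ with h | h
    · rw [le_div_iff_of_neg h, div_le_iff_of_neg h, log_le_iff_le_exp h₁, mul_comm s, mul_comm x]
      constructor <;> intro <;> linarith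
    · rw [le_div_iff₀ h, div_le_iff₀ h, le_log_iff_exp_le h₁, mul_comm s, mul_comm x]
      constructor <;> intro <;> linarith
  · refine iff_of_false (gumbelCDF_pos s).not_ge ?_
    rw [div_le_iff₀ h₂]
    nlinarith [exp_pos (γ * s)]
  · refine iff_of_true (gumbelCDF_lt_one s).le ?_
    rw [div_le_iff_of_neg (lt_of_le_of_ne (not_lt.1 h₂) h₀)]
    nlinarith [exp_pos (γ * s)]

/-- **Fisher–Tippett–Gnedenko theorem.** If `F(a_N + b_N x)^N` converges at every
continuity point to a non-degenerate CDF `H`, then `H` is, up to an affine change of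
variable, one of the extreme value distributions `H_γ` (Fréchet, Weibull or Gumbel). -/
theorem fisher_tippett_gnedenko
    (F : ℝ → ℝ) (hF : IsCDF F)
    (a : ℕ → ℝ) (b : ℕ → ℝ) (hb : ∀ N, 0 < b N)
    (H : ℝ → ℝ) (hH : IsCDF H) (hHnd : ¬ IsDegenerateCDF H)
    (hconv : ∀ x : ℝ, ContinuousAt H x →
      Tendsto (fun N : ℕ => F (a N + b N * x) ^ N) atTop (nhds (H x))) :
    ∃ A : ℝ, 0 < A ∧ ∃ B γ : ℝ, ∀ x : ℝ, H (A * x + B) = vonMisesCDF γ x := by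
  obtain ⟨φ, hφ⟩ := hF.exists_isGumbelQuantile
  obtain ⟨ψ, hψ⟩ := hH.exists_isGumbelQuantile
  have hquant : ∀ s, ContinuousAt ψ s →
      Tendsto (fun n : ℕ => (φ (s + log n) - a n) / b n) atTop (𝓝 (ψ s)) := fun s hs =>
    IsGumbelQuantile.tendsto (Q := fun (n : ℕ) s => (φ (s + log n) - a n) / b n) hH.1 hψ
      ((eventually_gt_atTop 0).mono fun n hn => hφ.rescaled_pow hF hn (a n) (hb n)) hconv hs
  have hprop := incrementsProportional_of_log_sub_log hψ.tendsto_left fun m k hm hk =>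
    incrementsProportional_log_sub_log hψ.monotone hψ.tendsto_left hquant hm hk
  obtain ⟨A, hA, B, γ, hψ_eq⟩ := exists_eq_of_incrementsProportional hψ.monotone
    (fun ⟨c, hc⟩ => hHnd (hψ.isDegenerateCDF_of_const hH hc)) hprop
  refine ⟨A, hA, B, γ, fun x => hψ.cdf_eq_of_forall_iff hH (vonMisesCDF_nonneg γ x)
    (vonMisesCDF_le_one γ x) fun s => ?_⟩
  rw [gumbelCDF_le_vonMisesCDF_iff, hψ_eq, add_le_add_iff_right, mul_le_mul_iff_right₀ hA]
end

section
/- Let F be a cumulative distribution function, F̃(z) = 1 − F(z), and ω_F = sup{z : F̃(z) > 0}. Then F belongs to the domain of attraction of the Gumbel distribution H_g — i.e., there exist a_N ∈ ℝ and b_N > 0 such that F(a_N + b_N x)^N converges at every continuity point to H_g(x) = exp(−e^{−x}) — if and only if there exists a finite ω_0 such that the integral ∫_{ω_0}^{ω_F} F̃(z) dz is finite and, defining R(t) = (1/F̃(t)) ∫_t^{ω_F} F̃(z) dz, one has for all x, lim_{t→ω_F} F̃(t + x R(t))/F̃(t) = e^{−x} (the limit t → ω_F meaning t → ∞ when ω_F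 = +∞ and t → ω_F from below when ω_F is finite). -/
open MeasureTheory Filter

open scoped Topology

/-- If antitone functions converge pointwise to `x ↦ e^{-x}`, they also converge along
convergent arguments. -/
lemma tendsto_exp_neg_of_tendsto {ι : Type*} {l : Filter ι} {H : ι → ℝ → ℝ} {s : ι → ℝ} {c : ℝ}
    (hH : ∀ᶠ i in l, Antitone (H i))
    (hlim : ∀ x, Tendsto (fun i => H i x) l (𝓝 (Real.exp (-x)))) (hs : Tendsto s l (𝓝 c)) :
    Tendsto (fun i => H i (s i)) l (𝓝 (Real.exp (-c))) := by
  have hcont : Continuous fun y : ℝ => Real.exp (-y) := by fun_prop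
  refine tendsto_order.2 ⟨fun u hu => ?_, fun u hu => ?_⟩
  · have hnear : ∀ᶠ y in 𝓝[>] c, u < Real.exp (-y) :=
      nhdsWithin_le_nhds (hcont.continuousAt.eventually (lt_mem_nhds hu))
    obtain ⟨y, hy, hcy⟩ := (hnear.and self_mem_nhdsWithin).exists
    filter_upwards [hH, hs.eventually (gt_mem_nhds hcy), (hlim y).eventually (lt_mem_nhds hy)]
      with i hi hsi hui using hui.trans_le (hi hsi.le)
  · have hnear : ∀ᶠ y in 𝓝[<] c, Real.exp (-y) < u :=
      nhdsWithin_le_nhds (hcont.continuousAt.eventually (gt_mem_nhds hu))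
    obtain ⟨y, hy, hcy⟩ := (hnear.and self_mem_nhdsWithin).exists
    filter_upwards [hH, hs.eventually (lt_mem_nhds hcy), (hlim y).eventually (gt_mem_nhds hy)]
      with i hi hsi hui using (hi hsi.le).trans_lt hui

/-- If antitone functions converge pointwise to `x ↦ e^{-x}`, convergence of values to `e^{-c}`
forces convergence of the arguments to `c`. -/
lemma tendsto_of_tendsto_exp_neg {ι : Type*} {l : Filter ι} {H : ι → ℝ → ℝ} {s : ι → ℝ} {c : ℝ}
    (hH : ∀ᶠ i in l, Antitone (H i))
    (hlim : ∀ x, Tendsto (fun i => H i x) l (𝓝 (Real.exp (-x))))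
    (hs : Tendsto (fun i => H i (s i)) l (𝓝 (Real.exp (-c)))) :
    Tendsto s l (𝓝 c) := by
  refine tendsto_order.2 ⟨fun y hy => ?_, fun y hy => ?_⟩
  · filter_upwards [hH, hs.eventually_lt (hlim y) (Real.exp_lt_exp.2 (neg_lt_neg hy))]
      with i hi hlt using hi.reflect_lt hlt
  · filter_upwards [hH, (hlim y).eventually_lt hs (Real.exp_lt_exp.2 (neg_lt_neg hy))]
      with i hi hlt using hi.reflect_lt hlt

/-- The filter of approach to the right end point of the support, for a function `G = 1 - F`:
it is generated by the sets `{t | 0 < G t < ε}`. -/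
def tailFilter (G : ℝ → ℝ) : Filter ℝ := comap G (𝓝[>] 0)

instance (G : ℝ → ℝ) : (tailFilter G).IsCountablyGenerated := by
  unfold tailFilter; infer_instance

lemma tendsto_tailFilter_iff {ι : Type*} {l : Filter ι} {G : ℝ → ℝ} {u : ι → ℝ} :
    Tendsto u l (tailFilter G) ↔
      Tendsto (fun i => G (u i)) l (𝓝 0) ∧ ∀ᶠ i in l, 0 < G (u i) := by
  rw [tailFilter, tendsto_comap_iff, tendsto_nhdsWithin_iff]
  rfl

lemma tendsto_zero_tailFilter (G : ℝ → ℝ) : Tendsto G (tailFilter G) (𝓝 0) :=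
  (tendsto_tailFilter_iff.1 tendsto_id).1

lemma eventually_pos_tailFilter (G : ℝ → ℝ) : ∀ᶠ t in tailFilter G, 0 < G t :=
  (tendsto_tailFilter_iff.1 tendsto_id).2

lemma tailFilter_hasBasis (G : ℝ → ℝ) :
    (tailFilter G).HasBasis (fun ε : ℝ => 0 < ε) fun ε => {t | 0 < G t ∧ G t < ε} :=
  (nhdsGT_basis (0 : ℝ)).comap G

/-- `G` is `Γ`-varying at the end of its support, with auxiliary function `β`. -/
def IsGammaVarying (G β : ℝ → ℝ) : Prop :=
  ∀ x : ℝ, Tendsto (fun t => G (t + β t * x) / G t) (tailFilter G) (𝓝 (Real.exp (-x)))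

lemma antitone_rescaled {G : ℝ → ℝ} (hG : Antitone G) {a b c : ℝ} (hb : 0 ≤ b) (hc : 0 ≤ c) :
    Antitone fun x => G (a + b * x) / c := by
  intro x y hxy
  have : G (a + b * y) ≤ G (a + b * x) := hG (by gcongr)
  dsimp only
  gcongr

namespace IsGammaVarying

variable {G β : ℝ → ℝ}

/-- The auxiliary function of an antitone function is eventually positive. -/
lemma eventually_pos (hG : Antitone G) (h : IsGammaVarying G β) :
    ∀ᶠ t in tailFilter G, 0 < β t := by
  have h1 : Real.exp (-1) < 1 := by simp
  filter_upwards [(h 1).eventually (gt_mem_nhds h1), eventually_pos_tailFilter G] with t ht hpos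
  rw [div_lt_one hpos] at ht
  have := hG.reflect_lt ht
  linarith

lemma eventually_antitone (hG : Antitone G) (h : IsGammaVarying G β) :
    ∀ᶠ t in tailFilter G, Antitone fun x => G (t + β t * x) / G t := by
  filter_upwards [h.eventually_pos hG, eventually_pos_tailFilter G] with t hβ hpos
  exact antitone_rescaled hG hβ.le hpos.le

lemma tendsto_add_mul (h : IsGammaVarying G β) (x : ℝ) :
    Tendsto (fun t => t + β t * x) (tailFilter G) (tailFilter G) := by
  refine tendsto_tailFilter_iff.2 ⟨?_, ?_⟩
  · have := (h x).mul (tendsto_zero_tailFilter G)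
    rw [mul_zero] at this
    refine this.congr' ?_
    filter_upwards [eventually_pos_tailFilter G] with t ht
    exact div_mul_cancel₀ _ ht.ne'
  · filter_upwards [(h x).eventually (lt_mem_nhds (Real.exp_pos _)), eventually_pos_tailFilter G]
      with t ht hpos
    exact (div_pos_iff_of_pos_right hpos).1 ht

/-- The auxiliary function is self-neglecting. -/
lemma tendsto_div (hG : Antitone G) (h : IsGammaVarying G β) (x : ℝ) :
    Tendsto (fun t => β (t + β t * x) / β t) (tailFilter G) (𝓝 1) := by
  have key : Tendsto (fun t => x + β (t + β t * x) / β t) (tailFilter G) (𝓝 (x + 1)) := by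
    refine tendsto_of_tendsto_exp_neg (h.eventually_antitone hG) h ?_
    have hmul := ((h 1).comp (h.tendsto_add_mul x)).mul (h x)
    rw [← Real.exp_add, show -1 + -x = -(x + 1) by ring] at hmul
    refine hmul.congr' ?_
    filter_upwards [h.eventually_pos hG, (h.tendsto_add_mul x).eventually
      (eventually_pos_tailFilter G)] with t hβ hpos
    have harg : t + β t * (x + β (t + β t * x) / β t)
        = t + β t * x + β (t + β t * x) * 1 := by field_simp; ring
    rw [harg, Function.comp_apply, div_mul_div_cancel₀ hpos.ne']
  simpa using key.sub_const x

/-- Changing the auxiliary function to an equivalent one. -/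
lemma congr_of_tendsto_div (hG : Antitone G) (h : IsGammaVarying G β) {ρ : ℝ → ℝ}
    (hρ : Tendsto (fun t => ρ t / β t) (tailFilter G) (𝓝 1)) : IsGammaVarying G ρ := by
  intro x
  have := tendsto_exp_neg_of_tendsto (h.eventually_antitone hG) h (by simpa using hρ.mul_const x)
  refine this.congr' ?_
  filter_upwards [h.eventually_pos hG] with t hβ
  congr 3
  field_simp

/-- On a neighbourhood of the end of the support, iterating `t ↦ t + β t` bounds the tail
integrals. -/
lemma eventually_intervalIntegral_le (hG : Antitone G) (h : IsGammaVarying G β) :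
    ∀ᶠ t in tailFilter G, ∀ z, t ≤ z → ∫ y in t..z, G y ≤ 4 * (G t * β t) := by
  have hhalf : Real.exp (-1) < 1 / 2 := by
    have := Real.exp_one_gt_d9
    rw [Real.exp_neg, inv_lt_comm₀ (Real.exp_pos _) (by norm_num)]
    linarith
  have hev : ∀ᶠ t in tailFilter G, 0 < β t ∧ 0 < G (t + β t) ∧ G (t + β t) ≤ 1 / 2 * G t ∧
      β (t + β t) ≤ 3 / 2 * β t := by
    filter_upwards [h.eventually_pos hG, (h 1).eventually (gt_mem_nhds hhalf),
      (h.tendsto_add_mul 1).eventually (eventually_pos_tailFilter G), eventually_pos_tailFilter G,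
      (h.tendsto_div hG 1).eventually (gt_mem_nhds (show (1 : ℝ) < 3 / 2 by norm_num))]
      with t hβ hG2 hpos' hpos hβ2
    rw [mul_one] at hG2 hpos' hβ2
    rw [div_lt_iff₀ hpos] at hG2
    rw [div_lt_iff₀ hβ] at hβ2
    exact ⟨hβ, hpos', hG2.le, hβ2.le⟩
  obtain ⟨ε, hε, hsub⟩ := (tailFilter_hasBasis G).eventually_iff.1 hev
  have hint : ∀ u v, IntervalIntegrable G volume u v := fun _ _ => hG.intervalIntegrable
  have htriv : ∀ u v, u ≤ v → ∫ y in u..v, G y ≤ G u * (v - u) := by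
    intro u v huv
    have := intervalIntegral.integral_mono_on huv (hint u v)
      (intervalIntegrable_const (c := G u)) (fun y hy => hG hy.1)
    rwa [intervalIntegral.integral_const, smul_eq_mul, mul_comm] at this
  have hiter : ∀ n : ℕ, ∀ t, 0 < G t → G t < ε → ∀ z, t ≤ z →
      ∫ y in t..z, G y ≤ 4 * (G t * β t) + (1 / 2) ^ n * (G t * (z - t)) := by
    intro n
    induction n with
    | zero =>
      intro t hpos hlt z hz
      have := htriv t z hz
      have := mul_pos hpos (hsub ⟨hpos, hlt⟩).1
      simp only [pow_zero, one_mul]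
      linarith
    | succ n ih =>
      intro t hpos hlt z hz
      obtain ⟨hβ, hpos', hG2, hβ2⟩ := hsub ⟨hpos, hlt⟩
      have hprod := mul_pos hpos hβ
      have hrem : 0 ≤ (1 / 2 : ℝ) ^ (n + 1) * (G t * (z - t)) :=
        mul_nonneg (by positivity) (mul_nonneg hpos.le (sub_nonneg.2 hz))
      rcases le_total z (t + β t) with hz' | hz'
      · have h1 := htriv t z hz
        have h2 : G t * (z - t) ≤ G t * β t := by gcongr; linarith
        linarith
      · have h1 := htriv t (t + β t) (by linarith)
        have h2 := ih (t + β t) hpos' (by linarith) z hz'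
        have h3 : G (t + β t) * β (t + β t) ≤ (1 / 2 * G t) * (3 / 2 * β t) := by
          have hnn : 0 ≤ 3 / 2 * β t := by positivity
          calc G (t + β t) * β (t + β t) ≤ G (t + β t) * (3 / 2 * β t) := by gcongr
            _ ≤ _ := by gcongr
        have h4 : (1 / 2 : ℝ) ^ n * (G (t + β t) * (z - (t + β t)))
            ≤ (1 / 2) ^ n * (1 / 2 * G t * (z - t)) := by
          have : 0 ≤ z - (t + β t) := sub_nonneg.2 hz'
          gcongr
          linarith
        have h5 : (1 / 2 : ℝ) ^ n * (1 / 2 * G t * (z - t))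
            = (1 / 2) ^ (n + 1) * (G t * (z - t)) := by ring
        rw [← intervalIntegral.integral_add_adjacent_intervals (hint t (t + β t)) (hint _ z)]
        have h6 : G t * (t + β t - t) = G t * β t := by ring
        linarith
  filter_upwards [(tailFilter_hasBasis G).mem_of_mem hε] with t ht z hz
  have hlim : Tendsto (fun n : ℕ => 4 * (G t * β t) + (1 / 2) ^ n * (G t * (z - t))) atTop
      (𝓝 (4 * (G t * β t) + 0 * (G t * (z - t)))) :=
    ((tendsto_pow_atTop_nhds_zero_of_lt_one (by norm_num) (by norm_num)).mul_const _).const_add _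
  rw [zero_mul, add_zero] at hlim
  exact ge_of_tendsto' hlim fun n => hiter n t ht.1 ht.2 z hz

lemma eventually_integrableOn (hG : Antitone G) (hG0 : ∀ z, 0 ≤ G z) (h : IsGammaVarying G β) :
    ∀ᶠ t in tailFilter G, IntegrableOn G (Set.Ioi t) := by
  filter_upwards [h.eventually_intervalIntegral_le hG] with t ht
  refine integrableOn_Ioi_of_intervalIntegral_norm_bounded (4 * (G t * β t)) t
    (fun z : ℝ => (hG.intervalIntegrable (a := t) (b := z)).1) tendsto_id ?_
  filter_upwards [eventually_ge_atTop t] with z hz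
  simpa only [Real.norm_of_nonneg (hG0 _)] using ht z hz

lemma eventually_integral_Ioi_le (hG : Antitone G) (hG0 : ∀ z, 0 ≤ G z)
    (h : IsGammaVarying G β) :
    ∀ᶠ t in tailFilter G, ∫ y in Set.Ioi t, G y ≤ 4 * (G t * β t) := by
  filter_upwards [h.eventually_intervalIntegral_le hG, h.eventually_integrableOn hG hG0]
    with t ht hint
  refine le_of_tendsto (intervalIntegral_tendsto_integral_Ioi t hint tendsto_id) ?_
  filter_upwards [eventually_ge_atTop t] with z hz using ht z hz

lemma tendsto_intervalIntegral (hG : Antitone G) (hG0 : ∀ z, 0 ≤ G z) (h : IsGammaVarying G β)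
    {M : ℝ} (hM : 0 ≤ M) :
    Tendsto (fun t => (∫ y in t..t + β t * M, G y) / G t / β t) (tailFilter G)
      (𝓝 (1 - Real.exp (-M))) := by
  have hlim : Tendsto (fun t => ∫ s in (0 : ℝ)..M, G (t + β t * s) / G t) (tailFilter G)
      (𝓝 (∫ s in (0 : ℝ)..M, Real.exp (-s))) := by
    refine intervalIntegral.tendsto_integral_filter_of_dominated_convergence (fun _ => 1) ?_ ?_
      intervalIntegrable_const (Eventually.of_forall fun x _ => h x)
    · filter_upwards with t
      exact ((hG.measurable.comp (by fun_prop)).div_const _).aestronglyMeasurable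
    · filter_upwards [h.eventually_pos hG, eventually_pos_tailFilter G] with t hβ hpos
      refine Eventually.of_forall fun x hx => ?_
      rw [Set.uIoc_of_le hM] at hx
      rw [Real.norm_of_nonneg (div_nonneg (hG0 _) hpos.le), div_le_one hpos]
      exact hG (by nlinarith [mul_pos hβ hx.1])
  have hval : ∫ s in (0 : ℝ)..M, Real.exp (-s) = 1 - Real.exp (-M) := by
    rw [intervalIntegral.integral_comp_neg (fun s => Real.exp s), integral_exp]
    simp
  rw [hval] at hlim
  refine hlim.congr' ?_
  filter_upwards [h.eventually_pos hG] with t hβ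
  rw [intervalIntegral.integral_div, intervalIntegral.integral_comp_add_mul G hβ.ne' t]
  simp only [mul_zero, add_zero, smul_eq_mul]
  ring

/-- The mean excess function is equivalent to any auxiliary function. -/
lemma tendsto_meanExcess_div (hG : Antitone G) (hG0 : ∀ z, 0 ≤ G z) (h : IsGammaVarying G β) :
    Tendsto (fun t => (∫ y in Set.Ioi t, G y) / G t / β t) (tailFilter G) (𝓝 1) := by
  rw [Metric.tendsto_nhds]
  intro ε hε
  obtain ⟨M, hMε, hM⟩ : ∃ M : ℝ, Real.exp (-M) < ε / 7 ∧ 0 ≤ M :=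
    (((Real.tendsto_exp_neg_atTop_nhds_zero).eventually
      (gt_mem_nhds (by positivity : 0 < ε / 7))).and (eventually_ge_atTop 0)).exists
  have hδ := Real.exp_pos (-M)
  have hrem : Tendsto (fun t => 4 * (G (t + β t * M) / G t * (β (t + β t * M) / β t)))
      (tailFilter G) (𝓝 (4 * (Real.exp (-M) * 1))) :=
    ((h M).mul (h.tendsto_div hG M)).const_mul 4
  filter_upwards [(Metric.tendsto_nhds.1 (h.tendsto_intervalIntegral hG hG0 hM)) _ hδ,
    hrem.eventually (gt_mem_nhds (show _ < 5 * Real.exp (-M) by linarith)),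
    (h.tendsto_add_mul M).eventually (h.eventually_integral_Ioi_le hG hG0),
    (h.tendsto_add_mul M).eventually (h.eventually_integrableOn hG hG0),
    h.eventually_integrableOn hG hG0, h.eventually_pos hG, eventually_pos_tailFilter G]
    with t h1 h2 h3 h4 h5 hβ hpos
  have hnn : 0 ≤ ∫ y in Set.Ioi (t + β t * M), G y := integral_nonneg hG0
  rw [← intervalIntegral.integral_interval_add_Ioi h5 h4, add_div, add_div]
  have h6 : (∫ y in Set.Ioi (t + β t * M), G y) / G t / β t
      ≤ 4 * (G (t + β t * M) / G t * (β (t + β t * M) / β t)) := by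
    calc _ ≤ (4 * (G (t + β t * M) * β (t + β t * M))) / G t / β t := by gcongr
      _ = _ := by ring
  have h7 : 0 ≤ (∫ y in Set.Ioi (t + β t * M), G y) / G t / β t := by positivity
  rw [Real.dist_eq, abs_lt] at h1 ⊢
  constructor <;> linarith [h1.1, h1.2]

end IsGammaVarying

lemma tendsto_mul_one_sub_of_tendsto_pow {p : ℕ → ℝ} {c : ℝ} (hp0 : ∀ n, 0 ≤ p n)
    (h : Tendsto (fun n => p n ^ n) atTop (𝓝 (Real.exp (-c)))) :
    Tendsto (fun n : ℕ => (n : ℝ) * (1 - p n)) atTop (𝓝 c) := by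
  have hpos : ∀ᶠ n in atTop, 0 < p n := by
    filter_upwards [h.eventually (lt_mem_nhds (Real.exp_pos _)), eventually_ge_atTop 1]
      with n hn hn1
    refine (hp0 n).lt_of_ne fun h0 => ?_
    rw [← h0, zero_pow (by omega)] at hn
    exact hn.false
  have hlog : Tendsto (fun n : ℕ => (n : ℝ) * -Real.log (p n)) atTop (𝓝 c) := by
    have := (h.log (Real.exp_pos _).ne').neg
    rw [Real.log_exp, neg_neg] at this
    refine this.congr fun n => ?_
    rw [Real.log_pow]
    ring
  have hlog0 : Tendsto (fun n => -Real.log (p n)) atTop (𝓝 0) := by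
    have := hlog.mul (tendsto_inv_atTop_nhds_zero_nat (𝕜 := ℝ))
    rw [mul_zero] at this
    refine this.congr' ?_
    filter_upwards [eventually_ne_atTop 0] with n hn
    field_simp
  have hone : Tendsto p atTop (𝓝 1) := by
    have := (Real.continuous_exp.tendsto _).comp hlog0.neg
    rw [neg_zero, Real.exp_zero] at this
    refine this.congr' ?_
    filter_upwards [hpos] with n hn
    simp [Real.exp_log hn]
  have hlow := hlog.mul hone
  rw [mul_one] at hlow
  refine tendsto_of_tendsto_of_tendsto_of_le_of_le' hlow hlog ?_ ?_
  · filter_upwards [hpos] with n hn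
    have h1 := Real.one_sub_inv_le_log_of_pos hn
    have h2 : p n * (1 - (p n)⁻¹) ≤ p n * Real.log (p n) := by gcongr
    have h3 : p n * (1 - (p n)⁻¹) = p n - 1 := by field_simp
    have h4 : (n : ℝ) * (p n - 1) ≤ n * (p n * Real.log (p n)) := by gcongr; linarith
    linarith
  · filter_upwards [hpos] with n hn
    have h1 := Real.log_le_sub_one_of_pos hn
    gcongr
    linarith

/-- If the rescaled tails converge to the exponential function, the tail is `Γ`-varying. -/
lemma exists_isGammaVarying_of_tendsto {G : ℝ → ℝ} (hG : Antitone G) {a b : ℕ → ℝ}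
    (hb : ∀ n, 0 < b n)
    (h : ∀ x : ℝ, Tendsto (fun n : ℕ => n * G (a n + b n * x)) atTop (𝓝 (Real.exp (-x)))) :
    (tailFilter G).NeBot ∧ ∃ β, IsGammaVarying G β := by
  have hatail : Tendsto a atTop (tailFilter G) := by
    have h0 : Tendsto (fun n : ℕ => n * G (a n)) atTop (𝓝 1) := by simpa using h 0
    refine tendsto_tailFilter_iff.2 ⟨?_, ?_⟩
    · have := h0.mul (tendsto_inv_atTop_nhds_zero_nat (𝕜 := ℝ))
      rw [mul_zero] at this
      refine this.congr' ?_
      filter_upwards [eventually_ne_atTop 0] with n hn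
      field_simp
    · filter_upwards [h0.eventually (lt_mem_nhds zero_lt_one)] with n hn
      exact pos_of_mul_pos_right hn (Nat.cast_nonneg n)
  refine ⟨hatail.neBot, fun t => b ⌊(G t)⁻¹⌋₊, ?_⟩
  set L := tailFilter G
  have hinv : Tendsto (fun t => (G t)⁻¹) L atTop :=
    tendsto_inv_nhdsGT_zero.comp tendsto_comap
  have hfloor : Tendsto (fun t => ⌊(G t)⁻¹⌋₊) L atTop := tendsto_nat_floor_atTop.comp hinv
  have hfloorG : Tendsto (fun t => (⌊(G t)⁻¹⌋₊ : ℝ) * G t) L (𝓝 1) := by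
    refine (tendsto_nat_floor_div_atTop.comp hinv).congr fun t => ?_
    simp
  set H : ℝ → ℝ → ℝ := fun t x => G (a ⌊(G t)⁻¹⌋₊ + b ⌊(G t)⁻¹⌋₊ * x) / G t with hHdef
  have hanti : ∀ᶠ t in L, Antitone (H t) := by
    filter_upwards [eventually_pos_tailFilter G] with t ht
    exact antitone_rescaled hG (hb _).le ht.le
  have hH : ∀ x, Tendsto (fun t => H t x) L (𝓝 (Real.exp (-x))) := by
    intro x
    have := ((h x).comp hfloor).div hfloorG one_ne_zero
    rw [div_one] at this
    refine this.congr' ?_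
    filter_upwards [hfloor.eventually (eventually_ge_atTop 1)] with t ht
    have hne : (⌊(G t)⁻¹⌋₊ : ℝ) ≠ 0 := by
      rw [Nat.cast_ne_zero]
      omega
    simp only [Pi.div_apply, Function.comp_apply, hHdef]
    exact mul_div_mul_left _ _ hne
  set s : ℝ → ℝ := fun t => (t - a ⌊(G t)⁻¹⌋₊) / b ⌊(G t)⁻¹⌋₊ with hsdef
  have harg : ∀ t x, a ⌊(G t)⁻¹⌋₊ + b ⌊(G t)⁻¹⌋₊ * (s t + x) = t + b ⌊(G t)⁻¹⌋₊ * x := by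
    intro t x
    have := (hb ⌊(G t)⁻¹⌋₊).ne'
    simp only [hsdef]
    rw [mul_add, mul_div_cancel₀ _ this]
    ring
  have hs : Tendsto s L (𝓝 0) := by
    refine tendsto_of_tendsto_exp_neg hanti hH ?_
    rw [neg_zero, Real.exp_zero]
    refine tendsto_const_nhds.congr' ?_
    filter_upwards [eventually_pos_tailFilter G] with t ht
    have := harg t 0
    rw [add_zero, mul_zero, add_zero] at this
    simp only [hHdef, this, div_self ht.ne']
  intro x
  have := tendsto_exp_neg_of_tendsto hanti hH (by simpa using hs.add_const x)
  refine this.congr fun t => ?_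
  simp only [hHdef, harg]

/-- A `Γ`-varying tail has norming sequences: `a n` is the `1 - 1 / n` quantile and `b n` is the
auxiliary function at `a n`. -/
lemma IsGammaVarying.exists_tendsto {G ρ : ℝ → ℝ} (hG : Antitone G)
    (hright : ∀ x, ContinuousWithinAt G (Set.Ici x) x) (hbot : Tendsto G atBot (𝓝 1))
    (htop : Tendsto G atTop (𝓝 0)) [hne : (tailFilter G).NeBot] (h : IsGammaVarying G ρ) :
    ∃ a b : ℕ → ℝ, (∀ n, 0 < b n) ∧
      ∀ x : ℝ, Tendsto (fun n : ℕ => n * G (a n + b n * x)) atTop (𝓝 (Real.exp (-x))) := by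
  have hG0 : ∀ z, 0 ≤ G z := hG.le_of_tendsto htop
  set a : ℕ → ℝ := fun n => sInf {z | G z ≤ (n : ℝ)⁻¹} with hadef
  have hlower : ∀ n : ℕ, 2 ≤ n → BddBelow {z | G z ≤ (n : ℝ)⁻¹} := by
    intro n hn
    have hn1 : (n : ℝ)⁻¹ < 1 := inv_lt_one_of_one_lt₀ (by exact_mod_cast hn)
    obtain ⟨w, hw⟩ := (hbot.eventually (lt_mem_nhds hn1)).exists
    exact ⟨w, fun z hz => (hG.reflect_lt (lt_of_le_of_lt hz hw)).le⟩
  have hbelow : ∀ n : ℕ, 2 ≤ n → ∀ z < a n, (n : ℝ)⁻¹ < G z := by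
    intro n hn z hz
    by_contra! hle
    exact hz.not_ge (csInf_le (hlower n hn) hle)
  have hat : ∀ n : ℕ, 2 ≤ n → G (a n) ≤ (n : ℝ)⁻¹ := by
    intro n hn
    have hn0 : 0 < (n : ℝ)⁻¹ := by positivity
    have hnon : {z | G z ≤ (n : ℝ)⁻¹}.Nonempty :=
      ((htop.eventually (gt_mem_nhds hn0)).exists).imp fun _ hz => hz.le
    refine le_of_tendsto ((hright (a n)).mono Set.Ioi_subset_Ici_self).tendsto ?_
    filter_upwards [self_mem_nhdsWithin] with y hy
    obtain ⟨z, hz, hzy⟩ := exists_lt_of_csInf_lt hnon hy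
    exact (hG hzy.le).trans hz
  have hpos : ∀ n : ℕ, 2 ≤ n → 0 < G (a n) := by
    intro n hn
    have hn0 : 0 < (n : ℝ)⁻¹ := by positivity
    obtain ⟨z, hz0, hzn⟩ := (tailFilter_hasBasis G).neBot_iff.1 hne hn0
    exact hz0.trans_le (hG (not_lt.1 fun hza => (hbelow n hn z hza).not_gt hzn))
  have hatail : Tendsto a atTop (tailFilter G) := by
    refine tendsto_tailFilter_iff.2 ⟨?_, ?_⟩
    · refine squeeze_zero' (Eventually.of_forall fun n => hG0 _) ?_
        (tendsto_inv_atTop_nhds_zero_nat (𝕜 := ℝ))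
      filter_upwards [eventually_ge_atTop 2] with n hn using hat n hn
    · filter_upwards [eventually_ge_atTop 2] with n hn using hpos n hn
  have hρ : ∀ᶠ n in atTop, 0 < ρ (a n) := hatail.eventually (h.eventually_pos hG)
  have hnG : Tendsto (fun n : ℕ => (n : ℝ) * G (a n)) atTop (𝓝 1) := by
    have hcont : Tendsto (fun x : ℝ => Real.exp (-x)) (𝓝[<] 0) (𝓝 1) := by
      have : Continuous fun x : ℝ => Real.exp (-x) := by fun_prop
      simpa using (this.tendsto 0).mono_left nhdsWithin_le_nhds
    refine tendsto_order.2 ⟨fun u hu => ?_, fun u hu => ?_⟩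
    · rcases le_or_gt u 0 with hu0 | hu0
      · filter_upwards [eventually_ge_atTop 2] with n hn
        have := hpos n hn
        have : (0 : ℝ) < n := by positivity
        exact hu0.trans_lt (by positivity)
      · obtain ⟨x, hx, hx0⟩ := ((hcont.eventually (gt_mem_nhds ((one_lt_inv₀ hu0).2 hu))).and
          self_mem_nhdsWithin).exists
        filter_upwards [eventually_ge_atTop 2, hρ,
          ((h x).comp hatail).eventually (gt_mem_nhds hx)] with n hn hρn hlt
        have hGn := hpos n hn
        have hn0 : (0 : ℝ) < n := by positivity
        have hstep := hbelow n hn (a n + ρ (a n) * x)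
          (by linarith [mul_neg_of_pos_of_neg hρn hx0])
        rw [Function.comp_apply, div_lt_iff₀ hGn] at hlt
        have := hstep.trans hlt
        rw [inv_mul_eq_div, inv_lt_comm₀ hn0 (by positivity), inv_div, div_lt_iff₀ hGn] at this
        exact this
    · filter_upwards [eventually_ge_atTop 2] with n hn
      have hn0 : (0 : ℝ) < n := by positivity
      calc (n : ℝ) * G (a n) ≤ n * (n : ℝ)⁻¹ := by gcongr; exact hat n hn
        _ = 1 := mul_inv_cancel₀ hn0.ne'
        _ < u := hu
  refine ⟨a, fun n => if 0 < ρ (a n) then ρ (a n) else 1, fun n => ?_, fun x => ?_⟩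
  · dsimp only
    split_ifs with hn
    exacts [hn, one_pos]
  · have := ((h x).comp hatail).mul hnG
    rw [mul_one] at this
    refine this.congr' ?_
    filter_upwards [hρ, eventually_ge_atTop 2] with n hn hn2
    have := (hpos n hn2).ne'
    simp only [if_pos hn, Function.comp_apply]
    field_simp

/-- Characterization of the Gumbel domain of attraction, with the approach to the right end point
expressed by `tailFilter`. -/
lemma IsCDF.gumbel_iff_tailFilter {F : ℝ → ℝ} (hF : IsCDF F) :
    (∃ (a b : ℕ → ℝ), (∀ N, 0 < b N) ∧
        ∀ x : ℝ,
          Tendsto (fun N : ℕ => F (a N + b N * x) ^ N) atTop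
            (𝓝 (Real.exp (-Real.exp (-x)))))
    ↔ (tailFilter fun z => 1 - F z).NeBot ∧
        (∃ ω0 : ℝ, IntegrableOn (fun z => 1 - F z) (Set.Ioi ω0)) ∧
        IsGammaVarying (fun z => 1 - F z) fun t => (∫ z in Set.Ioi t, (1 - F z)) / (1 - F t) := by
  obtain ⟨hmono, hright, hbot, htop⟩ := hF
  have hG : Antitone fun z => 1 - F z := fun x y hxy => sub_le_sub_left (hmono hxy) 1
  have hG0 : ∀ z, 0 ≤ 1 - F z := fun z => sub_nonneg.2 (hmono.ge_of_tendsto htop z)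
  constructor
  · rintro ⟨a, b, hb, h⟩
    obtain ⟨hne, β, hβ⟩ := exists_isGammaVarying_of_tendsto hG hb fun x =>
      tendsto_mul_one_sub_of_tendsto_pow (fun n => hmono.le_of_tendsto hbot _) (h x)
    exact ⟨hne, (hβ.eventually_integrableOn hG hG0).exists,
      hβ.congr_of_tendsto_div hG (hβ.tendsto_meanExcess_div hG hG0)⟩
  · rintro ⟨hne, -, h⟩
    obtain ⟨a, b, hb, hab⟩ := h.exists_tendsto hG (fun x => continuousWithinAt_const.sub (hright x))
      (by simpa using hbot.const_sub 1) (by simpa using htop.const_sub 1)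
    refine ⟨a, b, hb, fun x => ?_⟩
    have := Real.tendsto_one_add_pow_exp_of_tendsto (g := fun n => -(1 - F (a n + b n * x)))
      (t := -Real.exp (-x)) (by simpa only [mul_neg] using (hab x).neg)
    simpa using this

lemma tailFilter_eq_atTop {G : ℝ → ℝ} (hG : Antitone G) (hpos : ∀ z, 0 < G z)
    (htop : Tendsto G atTop (𝓝 0)) : tailFilter G = atTop := by
  refine le_antisymm ?_ (tendsto_tailFilter_iff.2 ⟨htop, Eventually.of_forall hpos⟩)
  refine atTop_basis.ge_iff.2 fun u _ => ?_
  filter_upwards [(tailFilter_hasBasis G).mem_of_mem (hpos u)] with t ht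
  exact (hG.reflect_lt ht.2).le

lemma tailFilter_eq_nhdsLT {G : ℝ → ℝ} (hG : Antitone G) {ω : ℝ} (hpos : ∀ z, 0 < G z ↔ z < ω)
    (hω : Tendsto G (𝓝[<] ω) (𝓝 0)) : tailFilter G = 𝓝[<] ω := by
  refine le_antisymm ?_ (tendsto_tailFilter_iff.2 ⟨hω, ?_⟩)
  · refine (nhdsLT_basis ω).ge_iff.2 fun u hu => ?_
    filter_upwards [(tailFilter_hasBasis G).mem_of_mem ((hpos u).2 hu)] with t ht
    exact ⟨hG.reflect_lt ht.2, (hpos t).1 ht.1⟩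
  · filter_upwards [self_mem_nhdsWithin] with t ht using (hpos t).2 ht

/-- If the tail approaches `0` at all, it does so at the finite right end point. -/
lemma tendsto_nhdsLT_zero_of_neBot {G : ℝ → ℝ} (hG : Antitone G) (hG0 : ∀ z, 0 ≤ G z) {ω : ℝ}
    (hpos : ∀ z, 0 < G z ↔ z < ω) (hne : (tailFilter G).NeBot) :
    Tendsto G (𝓝[<] ω) (𝓝 0) := by
  refine tendsto_order.2 ⟨fun u hu => Eventually.of_forall fun z => hu.trans_le (hG0 z),
    fun u hu => ?_⟩
  obtain ⟨z, hz0, hzu⟩ := (tailFilter_hasBasis G).neBot_iff.1 hne hu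
  filter_upwards [Ioo_mem_nhdsLT ((hpos z).1 hz0)] with t ht
  exact (hG ht.1.le).trans_lt hzu

/-- The mean excess condition excludes an atom at a finite right end point. -/
lemma tendsto_nhdsLT_zero_of_meanExcess {G : ℝ → ℝ} (hG : Antitone G) {ω : ℝ}
    (hpos : ∀ z, 0 < G z ↔ z < ω)
    (h : ∀ x : ℝ, Tendsto (fun t => G (t + x * ((∫ z in Set.Ioo t ω, G z) / G t)) / G t)
      (𝓝[<] ω) (𝓝 (Real.exp (-x)))) :
    Tendsto G (𝓝[<] ω) (𝓝 0) := by
  have hnn : ∀ z < ω, 0 ≤ G z := fun z hz => ((hpos z).2 hz).le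
  have hlt : ∀ᶠ t in 𝓝[<] ω, t < ω := self_mem_nhdsWithin
  obtain ⟨p, hp⟩ : ∃ p, Tendsto G (𝓝[<] ω) (𝓝 p) := ⟨_, hG.tendsto_nhdsLT ω⟩
  have hple : ∀ z < ω, p ≤ G z := by
    intro z hz
    refine le_of_tendsto hp ?_
    filter_upwards [Ioo_mem_nhdsLT hz] with t ht using hG ht.1.le
  have hp0 : 0 ≤ p := ge_of_tendsto hp (hlt.mono hnn)
  rcases hp0.eq_or_lt with rfl | hp0
  · exact hp
  exfalso
  have hhalf : ∀ᶠ t in 𝓝[<] ω,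
      p / G t ≤ G (t + 1 / 2 * ((∫ z in Set.Ioo t ω, G z) / G t)) / G t := by
    filter_upwards [hlt] with t ht
    have hGt := (hpos t).2 ht
    have hle : (∫ z in Set.Ioo t ω, G z) ≤ G t * (ω - t) := by
      have := norm_setIntegral_le_of_norm_le_const (f := G) (s := Set.Ioo t ω) (C := G t)
        (μ := volume) (by simp) fun z hz => by
          rw [Real.norm_of_nonneg (hnn z hz.2)]
          exact hG hz.1.le
      rw [Real.volume_real_Ioo_of_le ht.le] at this
      exact (Real.le_norm_self _).trans this
    have hR : (∫ z in Set.Ioo t ω, G z) / G t ≤ ω - t := by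
      rw [div_le_iff₀ hGt]
      linarith
    gcongr
    exact hple _ (by linarith)
  have hone := le_of_tendsto_of_tendsto (tendsto_const_nhds.div hp hp0.ne') (h (1 / 2)) hhalf
  rw [div_self hp0.ne'] at hone
  have : Real.exp (-(1 / 2)) < 1 := by rw [Real.exp_lt_one_iff]; norm_num
  linarith

lemma pos_iff_lt_of_isLUB {G : ℝ → ℝ} (hG : Antitone G)
    (hright : ∀ x, ContinuousWithinAt G (Set.Ici x) x) {ω : ℝ} (hω : IsLUB {z | 0 < G z} ω)
    (z : ℝ) : 0 < G z ↔ z < ω := by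
  refine ⟨fun hz => (hω.1 hz).lt_of_ne ?_, fun hz => ?_⟩
  · rintro rfl
    have hev : ∀ᶠ y in 𝓝[>] z, 0 < G y :=
      ((hright z).mono Set.Ioi_subset_Ici_self).eventually (lt_mem_nhds hz)
    obtain ⟨y, hy, hzy⟩ := (hev.and self_mem_nhdsWithin).exists
    exact (hω.1 hy).not_gt hzy
  · obtain ⟨w, hw, hzw, -⟩ := hω.exists_between hz
    exact lt_of_lt_of_le hw (hG hzw.le)

/-- **Domain of attraction of the Gumbel distribution.**  A CDF `F` is attracted to the
Gumbel law `H_g(x) = exp(−e^{−x})` (i.e. `F(a_N+b_N x)^N → H_g(x)` for some `a_N, b_N > 0`)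
if and only if, writing `F̃ = 1 − F`, `ω_F = sup{z : F̃(z) > 0}` and
`R(t) = (1/F̃(t)) ∫_t^{ω_F} F̃(z) dz`, the integral `∫_{ω_0}^{ω_F} F̃` is finite for some
finite `ω_0` and `F̃(t + x R(t))/F̃(t) → e^{−x}` as `t → ω_F`, for all `x` —
where `t → ω_F` means `t → ∞` if `ω_F = +∞` and `t → ω_F⁻` if `ω_F` is finite. -/
theorem gumbel_domain_of_attraction
    (F : ℝ → ℝ) (hF : IsCDF F) :
    (∃ (a b : ℕ → ℝ), (∀ N, 0 < b N) ∧
        ∀ x : ℝ,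
          Tendsto (fun N : ℕ => F (a N + b N * x) ^ N) atTop
            (nhds (Real.exp (-Real.exp (-x)))))
    ↔ ((¬ BddAbove {z : ℝ | 0 < 1 - F z} ∧
          (∃ ω0 : ℝ, IntegrableOn (fun z => 1 - F z) (Set.Ioi ω0)) ∧
          ∀ x : ℝ,
            Tendsto (fun t : ℝ =>
                (1 - F (t + x * ((∫ z in Set.Ioi t, (1 - F z)) / (1 - F t)))) / (1 - F t))
              atTop (nhds (Real.exp (-x))))
      ∨ (∃ ωF : ℝ, IsLUB {z : ℝ | 0 < 1 - F z} ωF ∧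
          (∃ ω0 : ℝ, IntegrableOn (fun z => 1 - F z) (Set.Ioo ω0 ωF)) ∧
          ∀ x : ℝ,
            Tendsto (fun t : ℝ =>
                (1 - F (t + x * ((∫ z in Set.Ioo t ωF, (1 - F z)) / (1 - F t)))) / (1 - F t))
              (nhdsWithin ωF (Set.Iio ωF)) (nhds (Real.exp (-x))))) := by
  have hG : Antitone fun z => 1 - F z := fun x y hxy => sub_le_sub_left (hF.1 hxy) 1
  have hG0 : ∀ z, 0 ≤ 1 - F z := fun z => sub_nonneg.2 (hF.1.ge_of_tendsto hF.2.2.2 z)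
  have hright : ∀ x, ContinuousWithinAt (fun z => 1 - F z) (Set.Ici x) x :=
    fun x => continuousWithinAt_const.sub (hF.2.1 x)
  have htop : Tendsto (fun z => 1 - F z) atTop (𝓝 0) := by simpa using hF.2.2.2.const_sub 1
  have hbot : Tendsto (fun z => 1 - F z) atBot (𝓝 1) := by simpa using hF.2.2.1.const_sub 1
  have hshape : IsGammaVarying (fun z => 1 - F z)
      (fun t => (∫ z in Set.Ioi t, (1 - F z)) / (1 - F t)) ↔
      ∀ x : ℝ, Tendsto (fun t : ℝ =>
        (1 - F (t + x * ((∫ z in Set.Ioi t, (1 - F z)) / (1 - F t)))) / (1 - F t))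
        (tailFilter fun z => 1 - F z) (𝓝 (Real.exp (-x))) := by
    simp only [IsGammaVarying, mul_comm]
  rw [hF.gumbel_iff_tailFilter, hshape]
  by_cases hbdd : BddAbove {z : ℝ | 0 < 1 - F z}
  · have hnon : {z : ℝ | 0 < 1 - F z}.Nonempty :=
      (hbot.eventually (lt_mem_nhds zero_lt_one)).exists
    obtain ⟨ω, hω⟩ : ∃ ω, IsLUB {z : ℝ | 0 < 1 - F z} ω := ⟨_, isLUB_csSup hnon hbdd⟩
    have hpos := pos_iff_lt_of_isLUB hG hright hω
    have hzero : ∀ u, ∀ z ∈ Set.Ioi u \ Set.Ioo u ω, 1 - F z = 0 := by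
      rintro u z ⟨hz, hz'⟩
      refine le_antisymm (not_lt.1 fun h => hz' ⟨hz, (hpos z).1 h⟩) (hG0 z)
    have hintegral : ∀ u, ∫ z in Set.Ioo u ω, (1 - F z) = ∫ z in Set.Ioi u, (1 - F z) := fun u =>
      (setIntegral_eq_of_subset_of_forall_sdiff_eq_zero measurableSet_Ioi Set.Ioo_subset_Ioi_self
        (hzero u)).symm
    have hintegrable : ∀ u, IntegrableOn (fun z => 1 - F z) (Set.Ioo u ω) ↔
        IntegrableOn (fun z => 1 - F z) (Set.Ioi u) := fun u =>
      ⟨fun h => h.of_forall_sdiff_eq_zero measurableSet_Ioi (hzero u),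
        fun h => h.mono_set Set.Ioo_subset_Ioi_self⟩
    constructor
    · rintro ⟨hne, hint, hlim⟩
      rw [tailFilter_eq_nhdsLT hG hpos (tendsto_nhdsLT_zero_of_neBot hG hG0 hpos hne)] at hlim
      refine Or.inr ⟨ω, hω, ?_, ?_⟩
      · simpa only [hintegrable] using hint
      · simpa only [hintegral] using hlim
    · rintro (⟨hunb, -⟩ | ⟨ω', hω', hint, hlim⟩)
      · exact absurd hbdd hunb
      obtain rfl := hω'.unique hω
      rw [tailFilter_eq_nhdsLT hG hpos (tendsto_nhdsLT_zero_of_meanExcess hG hpos hlim)]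
      simp only [hintegrable] at hint
      simp only [hintegral] at hlim
      exact ⟨inferInstance, hint, hlim⟩
  · have hpos : ∀ z, 0 < 1 - F z := by
      intro z
      obtain ⟨w, hw, hzw⟩ := not_bddAbove_iff.1 hbdd z
      exact lt_of_lt_of_le hw (hG hzw.le)
    rw [tailFilter_eq_atTop hG hpos htop]
    constructor
    · rintro ⟨-, h⟩
      exact Or.inl ⟨hbdd, h⟩
    · rintro (⟨-, h⟩ | ⟨ω, hω, -⟩)
      · exact ⟨inferInstance, h⟩
      · exact absurd hω.bddAbove hbdd
end

section
/- For each N, let (x_1,...,x_N) be a centered jointly Gaussian vector with unit variances and constant pairwise correlation Cov(x_i, x_j) = r_N ≥ 0 for all i ≠ j, and let y_N = max(x_1,...,x_N). Define b_N = (2 ln N)^{−1/2} and a_N = 1/b_N − (b_N/2)(ln ln N + ln 4π). If r_N ln N converges to a finite limit τ ≥ 0 as N → ∞, then z = (y_N − a_N)/b_N has a limit distribution: (i) if τ = 0, the limit is the Gumbel distribution with cumulative function exp(−e^{−z}), as in the i.i.d. case; (ii) if τ > 0, the limit is the convolution of the translated Gumbel distribution with density exp(−(z+τ) − e^{−(z+τ)})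 and a Gaussian distribution with zero mean and variance 2τ. If instead r_N ln N → ∞, then z' = (y_N − a_N √(1−r_N))/√(r_N) converges in distribution to the standard normal law N(0,1). -/
open MeasureTheory ProbabilityTheory Filter

/-- The linear map realizing a constantly correlated vector from a common standard variable `v`
and individual standard variables `ξ i`. -/
noncomputable def commonFactorMap (ι : Type*) [Fintype ι] (r : ℝ) :
    ℝ × (ι → ℝ) →L[ℝ] (ι → ℝ) :=
  ContinuousLinearMap.pi fun i =>
    √r • ContinuousLinearMap.fst ℝ ℝ (ι → ℝ) +
      √(1 - r) • (ContinuousLinearMap.proj i).comp (ContinuousLinearMap.snd ℝ ℝ (ι → ℝ))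

@[simp]
lemma commonFactorMap_apply {ι : Type*} [Fintype ι] (r : ℝ) (p : ℝ × (ι → ℝ)) (i : ι) :
    commonFactorMap ι r p i = √r * p.1 + √(1 - r) * p.2 i := by
  simp [commonFactorMap]

lemma charFunDual_gaussianReal_zero_one (L : StrongDual ℝ ℝ) :
    charFunDual (gaussianReal 0 1) L = Complex.exp (-((L 1 : ℝ) : ℂ) ^ 2 / 2) := by
  have h : charFunDual (gaussianReal 0 1) L = charFun (gaussianReal 0 1) (L 1) := by
    rw [charFunDual_apply, charFun_apply_real]
    congr 1 with x
    have : L x = L 1 * x := by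
      conv_lhs => rw [← mul_one x, ← smul_eq_mul, map_smul, smul_eq_mul, mul_comm]
    rw [this]; push_cast; rfl
  rw [h, charFun_gaussianReal]
  congr 1; simp; ring

lemma strongDual_pi_apply {ι : Type*} [Fintype ι] [DecidableEq ι] (L : StrongDual ℝ (ι → ℝ))
    (x : ι → ℝ) : L x = ∑ i, L (Pi.single i 1) * x i := by
  conv_lhs => rw [pi_eq_sum_univ' x, map_sum]
  refine Finset.sum_congr rfl fun i _ => ?_
  rw [map_smul, smul_eq_mul, mul_comm]

lemma charFunDual_map_commonFactorMap {ι : Type*} [Fintype ι] [DecidableEq ι] {r : ℝ}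
    (h0 : 0 ≤ r) (h1 : r ≤ 1) (L : StrongDual ℝ (ι → ℝ)) :
    charFunDual (((gaussianReal 0 1).prod (Measure.pi fun _ : ι => gaussianReal 0 1)).map
      (commonFactorMap ι r)) L =
      Complex.exp (-((r * (∑ i, L (Pi.single i 1)) ^ 2 +
        (1 - r) * ∑ i, (L (Pi.single i 1)) ^ 2 : ℝ) : ℂ) / 2) := by
  rw [charFunDual_map, charFunDual_prod, charFunDual_pi, charFunDual_gaussianReal_zero_one]
  simp_rw [charFunDual_gaussianReal_zero_one]
  rw [← Complex.exp_sum, ← Complex.exp_add]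
  have e1 : ((L.comp (commonFactorMap ι r)).comp (ContinuousLinearMap.inl ℝ ℝ (ι → ℝ))) 1 =
      √r * ∑ i, L (Pi.single i 1) := by
    simp only [ContinuousLinearMap.comp_apply]
    rw [strongDual_pi_apply, Finset.mul_sum]
    exact Finset.sum_congr rfl fun i _ => by simp [mul_comm]
  have e2 : ∀ i, (((L.comp (commonFactorMap ι r)).comp
      (ContinuousLinearMap.inr ℝ ℝ (ι → ℝ))).comp (.single ℝ (fun _ => ℝ) i)) 1 =
      √(1 - r) * L (Pi.single i 1) := by
    intro i
    simp only [ContinuousLinearMap.comp_apply]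
    rw [strongDual_pi_apply]
    simp [Pi.single_apply, mul_comm]
  simp_rw [e2]
  rw [e1]
  congr 1
  have s1 : ((√r : ℝ) : ℂ) ^ 2 = r := by rw [← Complex.ofReal_pow, Real.sq_sqrt h0]
  have s2 : ((√(1 - r) : ℝ) : ℂ) ^ 2 = 1 - r := by
    rw [← Complex.ofReal_pow, Real.sq_sqrt (by linarith)]; push_cast; rfl
  push_cast
  simp_rw [mul_pow, s1, s2]
  rw [← Finset.sum_div, Finset.sum_neg_distrib, ← Finset.mul_sum]
  ring

lemma sum_mul_mul_ite_eq {ι : Type*} [Fintype ι] [DecidableEq ι] (c : ι → ℝ) (r : ℝ) :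
    ∑ i, ∑ j, c i * c j * (if i = j then 1 else r) =
      r * (∑ i, c i) ^ 2 + (1 - r) * ∑ i, (c i) ^ 2 := by
  have : ∀ i j, c i * c j * (if i = j then 1 else r) =
      r * (c i * c j) + (1 - r) * (if i = j then c i * c j else 0) := by
    intro i j; split_ifs <;> ring
  simp_rw [this, Finset.sum_add_distrib, ← Finset.mul_sum]
  simp only [Finset.sum_ite_eq, Finset.mem_univ, if_true]
  simp_rw [sq, Finset.sum_mul]

/-- A vector all of whose linear combinations have the centered Gaussian law dictated by the
constant correlation matrix is distributed as its common factor representation. -/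
lemma map_eq_map_commonFactorMap {Ω ι : Type*} [Fintype ι] [DecidableEq ι] [MeasurableSpace Ω]
    (μ : Measure Ω) [IsProbabilityMeasure μ] {Y : ι → Ω → ℝ} (hY : ∀ i, Measurable (Y i)) {r : ℝ}
    (h0 : 0 ≤ r) (h1 : r ≤ 1)
    (hgauss : ∀ c : ι → ℝ, μ.map (fun ω => ∑ i, c i * Y i ω) =
      gaussianReal 0 (Real.toNNReal (∑ i, ∑ j, c i * c j * (if i = j then 1 else r)))) :
    μ.map (fun ω i => Y i ω) =
      ((gaussianReal 0 1).prod (Measure.pi fun _ : ι => gaussianReal 0 1)).map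
        (commonFactorMap ι r) := by
  have hm : Measurable (fun ω i => Y i ω) := measurable_pi_lambda _ hY
  have : IsProbabilityMeasure (μ.map (fun ω i => Y i ω)) :=
    Measure.isProbabilityMeasure_map hm.aemeasurable
  have : IsProbabilityMeasure (((gaussianReal 0 1).prod
      (Measure.pi fun _ : ι => gaussianReal 0 1)).map (commonFactorMap ι r)) :=
    Measure.isProbabilityMeasure_map (by fun_prop)
  refine Measure.ext_of_charFunDual (funext fun L => ?_)
  rw [charFunDual_map_commonFactorMap h0 h1, charFunDual_eq_charFun_map_one,
    Measure.map_map (by fun_prop) hm]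
  have : (L ∘ fun ω i => Y i ω) = fun ω => ∑ i, L (Pi.single i 1) * Y i ω := by
    ext ω; simp only [Function.comp]; rw [strongDual_pi_apply]
  rw [this, hgauss, charFun_gaussianReal, sum_mul_mul_ite_eq, Real.coe_toNNReal]
  · congr 1; push_cast; ring
  · have := Finset.sum_nonneg fun i (_ : i ∈ Finset.univ) => sq_nonneg (L (Pi.single i 1))
    have : 0 ≤ 1 - r := by linarith
    positivity

lemma measureReal_forall_le_eq_integral {Ω ι : Type*} [Fintype ι] [DecidableEq ι]
    [MeasurableSpace Ω] (μ : Measure Ω) [IsProbabilityMeasure μ] {Y : ι → Ω → ℝ}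
    (hY : ∀ i, Measurable (Y i)) {r : ℝ} (h0 : 0 ≤ r) (h1 : r ≤ 1)
    (hgauss : ∀ c : ι → ℝ, μ.map (fun ω => ∑ i, c i * Y i ω) =
      gaussianReal 0 (Real.toNNReal (∑ i, ∑ j, c i * c j * (if i = j then 1 else r)))) (t : ℝ) :
    μ.real {ω | ∀ i, Y i ω ≤ t} =
      ∫ v, (gaussianReal 0 1).real {x | √r * v + √(1 - r) * x ≤ t} ^ Fintype.card ι
        ∂(gaussianReal 0 1) := by
  have hm : Measurable (fun ω i => Y i ω) := measurable_pi_lambda _ hY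
  have hS : MeasurableSet {y : ι → ℝ | ∀ i, y i ≤ t} := by
    rw [Set.ofPred_forall]
    exact MeasurableSet.iInter fun i => measurableSet_le (by fun_prop) (by fun_prop)
  have e1 : μ.real {ω | ∀ i, Y i ω ≤ t} =
      (μ.map (fun ω i => Y i ω)).real {y : ι → ℝ | ∀ i, y i ≤ t} := by
    rw [map_measureReal_apply hm hS]; rfl
  rw [e1, map_eq_map_commonFactorMap μ hY h0 h1 hgauss,
    map_measureReal_apply (by fun_prop) hS, ← integral_indicator_one (by measurability),
    integral_prod]
  · congr 1 with v
    have : ∀ y : ι → ℝ, (commonFactorMap ι r ⁻¹' {y : ι → ℝ | ∀ i, y i ≤ t}).indicator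
        (1 : ℝ × (ι → ℝ) → ℝ) (v, y) =
        (Set.univ.pi fun _ => {x : ℝ | √r * v + √(1 - r) * x ≤ t}).indicator 1 y := by
      classical
      intro y
      simp [Set.indicator_apply]
    simp_rw [this]
    have hms : MeasurableSet {x : ℝ | √r * v + √(1 - r) * x ≤ t} :=
      measurableSet_le (by fun_prop) (by fun_prop)
    rw [integral_indicator_one (MeasurableSet.univ_pi fun _ => hms), measureReal_def,
      Measure.pi_pi]
    simp [measureReal_def, Finset.prod_const]
  · exact (integrable_const (1 : ℝ)).indicator ((by fun_prop : Measurable (commonFactorMap ι r)) hS)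

/-- A constant pairwise correlation of unit-variance Gaussian variables is at most one. -/
lemma le_one_of_map_eq_gaussianReal {Ω : Type*} [MeasurableSpace Ω] (μ : Measure Ω)
    [IsProbabilityMeasure μ] {Y : ℕ → Ω → ℝ} (hY : ∀ i, Measurable (Y i)) {r : ℝ}
    {N : ℕ} (hN : 2 ≤ N)
    (hgauss : ∀ c : ℕ → ℝ,
      Measure.map (fun ω => ∑ i ∈ Finset.range N, c i * Y i ω) μ =
        gaussianReal 0
          (Real.toNNReal (∑ i ∈ Finset.range N, ∑ j ∈ Finset.range N,
            c i * c j * (if i = j then 1 else r)))) : r ≤ 1 := by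
  by_contra! h
  have key : ∀ p q : ℝ, μ.map (fun ω => p * Y 0 ω + q * Y 1 ω) =
      gaussianReal 0 (Real.toNNReal (p ^ 2 + q ^ 2 + 2 * r * p * q)) := by
    intro p q
    obtain ⟨n, rfl⟩ := Nat.exists_eq_add_of_le hN
    have := hgauss (fun i => if i = 0 then p else if i = 1 then q else 0)
    simp only [add_comm 2 n, Finset.sum_range_succ', ite_mul, mul_ite] at this
    simp at this
    convert this using 3 <;> ring
  have hv : ∀ p q : ℝ, ∫ ω, (p * Y 0 ω + q * Y 1 ω) ^ 2 ∂μ =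
      (Real.toNNReal (p ^ 2 + q ^ 2 + 2 * r * p * q) : ℝ) := by
    intro p q
    have h1 := variance_id_gaussianReal (μ := 0)
      (v := Real.toNNReal (p ^ 2 + q ^ 2 + 2 * r * p * q))
    rw [← key, variance_of_integral_eq_zero (by fun_prop)
      (by rw [key]; simp),
      integral_map (by fun_prop) (by fun_prop)] at h1
    simpa [Function.comp] using h1
  have hL : ∀ i, i = 0 ∨ i = 1 → MemLp (Y i) 2 μ := by
    intro i hi
    have : μ.map (Y i) = gaussianReal 0 1 := by
      rcases hi with rfl | rfl
      · simpa using key 1 0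
      · simpa using key 0 1
    have h2 := memLp_id_gaussianReal (μ := 0) (v := 1) 2
    rw [← this, memLp_map_measure_iff (by fun_prop) (by fun_prop)] at h2
    simpa using h2
  have a1 : Integrable (fun ω => (1 * Y 0 ω + 1 * Y 1 ω) ^ 2) μ :=
    (((hL 0 (by simp)).const_mul 1).add ((hL 1 (by simp)).const_mul 1)).integrable_sq
  have a2 : Integrable (fun ω => (1 * Y 0 ω + (-1) * Y 1 ω) ^ 2) μ :=
    (((hL 0 (by simp)).const_mul 1).add ((hL 1 (by simp)).const_mul (-1))).integrable_sq
  have b1 : Integrable (fun ω => (1 * Y 0 ω + 0 * Y 1 ω) ^ 2) μ :=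
    (((hL 0 (by simp)).const_mul 1).add ((hL 1 (by simp)).const_mul 0)).integrable_sq
  have b2 : Integrable (fun ω => (0 * Y 0 ω + 1 * Y 1 ω) ^ 2) μ :=
    (((hL 0 (by simp)).const_mul 0).add ((hL 1 (by simp)).const_mul 1)).integrable_sq
  have e : ∫ ω, (1 * Y 0 ω + 1 * Y 1 ω) ^ 2 ∂μ + ∫ ω, (1 * Y 0 ω + (-1) * Y 1 ω) ^ 2 ∂μ =
      2 * (∫ ω, (1 * Y 0 ω + 0 * Y 1 ω) ^ 2 ∂μ + ∫ ω, (0 * Y 0 ω + 1 * Y 1 ω) ^ 2 ∂μ) := by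
    rw [← integral_add a1 a2, ← integral_add b1 b2, ← integral_const_mul]
    congr 1 with ω; ring
  simp only [hv] at e
  rw [Real.coe_toNNReal (1 ^ 2 + 1 ^ 2 + 2 * r * 1 * 1) (by nlinarith),
    Real.coe_toNNReal (1 ^ 2 + 0 ^ 2 + 2 * r * 1 * 0) (by norm_num),
    Real.coe_toNNReal (0 ^ 2 + 1 ^ 2 + 2 * r * 0 * 1) (by norm_num)] at e
  have := NNReal.coe_nonneg (Real.toNNReal (1 ^ 2 + (-1) ^ 2 + 2 * r * 1 * (-1)))
  linarith

lemma gaussianPDFReal_zero_one (x : ℝ) :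
    gaussianPDFReal 0 1 x = (√(2 * Real.pi))⁻¹ * Real.exp (-x ^ 2 / 2) := by
  simp [gaussianPDFReal]

lemma hasDerivAt_gaussianPDFReal_zero_one (x : ℝ) :
    HasDerivAt (gaussianPDFReal 0 1) (-x * gaussianPDFReal 0 1 x) x := by
  have h : HasDerivAt (fun x : ℝ => (√(2 * Real.pi))⁻¹ * Real.exp (-x ^ 2 / 2))
      ((√(2 * Real.pi))⁻¹ * (Real.exp (-x ^ 2 / 2) * (-(2 * x) / 2))) x := by
    refine HasDerivAt.const_mul _ (HasDerivAt.exp ?_)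
    simpa using ((hasDerivAt_pow 2 x).neg.div_const 2)
  rw [funext gaussianPDFReal_zero_one]
  convert h using 1
  ring

lemma tendsto_gaussianPDFReal_zero_one_atTop :
    Tendsto (gaussianPDFReal 0 1) atTop (nhds 0) := by
  rw [funext gaussianPDFReal_zero_one]
  have : Tendsto (fun x : ℝ => -x ^ 2 / 2) atTop atBot := by
    simp_rw [neg_div]
    exact tendsto_neg_atTop_atBot.comp ((tendsto_pow_atTop two_ne_zero).atTop_div_const two_pos)
  simpa using (Real.tendsto_exp_atBot.comp this).const_mul (√(2 * Real.pi))⁻¹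

lemma hasDerivAt_gaussianReal_Iic (x : ℝ) :
    HasDerivAt (fun u => (gaussianReal 0 1).real (Set.Iic u)) (gaussianPDFReal 0 1 x) x := by
  have hint : Integrable (gaussianPDFReal 0 1) := integrable_gaussianPDFReal 0 1
  have hc : Continuous (gaussianPDFReal 0 1) :=
    continuous_iff_continuousAt.2 fun y => (hasDerivAt_gaussianPDFReal_zero_one y).continuousAt
  have e : (fun u => (gaussianReal 0 1).real (Set.Iic u)) = fun u =>
      (∫ t in Set.Iic 0, gaussianPDFReal 0 1 t) + ∫ t in (0 : ℝ)..u, gaussianPDFReal 0 1 t := by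
    ext u
    rw [measureReal_def, gaussianReal_apply_eq_integral 0 one_ne_zero, ENNReal.toReal_ofReal
      (integral_nonneg fun t => gaussianPDFReal_nonneg 0 1 t),
      ← intervalIntegral.integral_Iic_sub_Iic hint.integrableOn hint.integrableOn]
    ring
  rw [e]
  exact (intervalIntegral.integral_hasDerivAt_right (hc.intervalIntegrable _ _)
    (hc.stronglyMeasurableAtFilter _ _) hc.continuousAt).const_add _

/-- **Mills ratio** of the standard normal law. -/
lemma tendsto_gaussian_tail_div_atTop :
    Tendsto (fun u => (1 - (gaussianReal 0 1).real (Set.Iic u)) / (gaussianPDFReal 0 1 u / u))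
      atTop (nhds 1) := by
  have hpos : ∀ x, 0 < gaussianPDFReal 0 1 x := fun x => gaussianPDFReal_pos 0 1 x one_ne_zero
  have hT : Tendsto (fun u => 1 - (gaussianReal 0 1).real (Set.Iic u)) atTop (nhds 0) := by
    have h := (tendsto_cdf_atTop (gaussianReal 0 1)).congr (cdf_eq_real _)
    simpa using h.const_sub 1
  refine HasDerivAt.lhopital_zero_atTop
    (f' := fun u => -gaussianPDFReal 0 1 u)
    (g' := fun u => (-u * gaussianPDFReal 0 1 u * u - gaussianPDFReal 0 1 u * 1) / u ^ 2)
    ?_ ?_ ?_ hT ?_ ?_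
  · exact Eventually.of_forall fun x => (hasDerivAt_gaussianReal_Iic x).const_sub 1
  · filter_upwards [eventually_gt_atTop 0] with x hx
    exact (hasDerivAt_gaussianPDFReal_zero_one x).div (hasDerivAt_id x) hx.ne'
  · filter_upwards [eventually_gt_atTop 0] with x hx
    have := hpos x
    refine div_ne_zero (ne_of_lt ?_) (by positivity)
    nlinarith [mul_pos hx (mul_pos hx this)]
  · simpa using tendsto_gaussianPDFReal_zero_one_atTop.div_atTop tendsto_id
  · have h : Tendsto (fun u : ℝ => (1 + (u ^ 2)⁻¹)⁻¹) atTop (nhds 1) := by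
      have : Tendsto (fun u : ℝ => (u ^ 2)⁻¹) atTop (nhds 0) :=
        tendsto_inv_atTop_zero.comp (tendsto_pow_atTop two_ne_zero)
      simpa using (this.const_add 1).inv₀ (by norm_num)
    refine h.congr' ?_
    filter_upwards [eventually_gt_atTop 0] with x hx
    have := hpos x
    have h2 : (-x * gaussianPDFReal 0 1 x * x - gaussianPDFReal 0 1 x * 1) =
      -(gaussianPDFReal 0 1 x * (x ^ 2 + 1)) := by ring
    rw [h2]
    field_simp

/-- The scaling constant `b_N` in the Gumbel limit of Gaussian maxima. -/
noncomputable def gumbelScale (N : ℕ) : ℝ := 1 / √(2 * Real.log N)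

/-- The centering constant `a_N` in the Gumbel limit of Gaussian maxima. -/
noncomputable def gumbelCenter (N : ℕ) : ℝ :=
  1 / gumbelScale N - (gumbelScale N / 2) * (Real.log (Real.log N) + Real.log (4 * Real.pi))

lemma tendsto_log_natCast_atTop : Tendsto (fun N : ℕ => Real.log N) atTop atTop :=
  Real.tendsto_log_atTop.comp tendsto_natCast_atTop_atTop

lemma tendsto_log_log_div_sqrt_log :
    Tendsto (fun N : ℕ => Real.log (Real.log N) / √(Real.log N)) atTop (nhds 0) := by
  have h := (isLittleO_log_rpow_atTop (r := 1 / 2) (by norm_num)).tendsto_div_nhds_zero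
  refine (h.comp tendsto_log_natCast_atTop).congr fun N => ?_
  simp [Real.sqrt_eq_rpow]

lemma gumbelScale_pos {N : ℕ} (hN : 2 ≤ N) : 0 < gumbelScale N := by
  have : 0 < Real.log N := Real.log_pos (by exact_mod_cast hN)
  unfold gumbelScale
  positivity

lemma tendsto_gumbelScale : Tendsto gumbelScale atTop (nhds 0) := by
  unfold gumbelScale
  exact Tendsto.div_atTop tendsto_const_nhds
    (Real.tendsto_sqrt_atTop.comp (tendsto_log_natCast_atTop.const_mul_atTop two_pos))

/-- The quantity `(log log N + log 4π) b_N` vanishes in the limit. -/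
lemma tendsto_log_log_mul_gumbelScale :
    Tendsto (fun N : ℕ => (Real.log (Real.log N) + Real.log (4 * Real.pi)) * gumbelScale N) atTop
      (nhds 0) := by
  have h1 := tendsto_log_log_div_sqrt_log.mul_const (1 / √2)
  have h2 := tendsto_gumbelScale.const_mul (Real.log (4 * Real.pi))
  have := h1.add h2
  simp only [mul_zero, zero_mul, add_zero] at this
  refine this.congr fun N => ?_
  rw [gumbelScale, Real.sqrt_mul (by norm_num)]
  simp only [mul_inv, div_eq_mul_inv]
  ring

lemma tendsto_gumbelCenter_mul_gumbelScale :
    Tendsto (fun N : ℕ => gumbelCenter N * gumbelScale N) atTop (nhds 1) := by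
  have h := (tendsto_log_log_mul_gumbelScale.mul tendsto_gumbelScale).mul_const (1 / 2 : ℝ)
  have h' := h.const_sub 1
  simp only [mul_zero, zero_mul, sub_zero] at h'
  refine h'.congr' ?_
  filter_upwards [eventually_ge_atTop 2] with N hN
  have := gumbelScale_pos hN
  rw [gumbelCenter]
  field_simp

/-- Asymptotics of `N (1 - Φ(a_N + b_N x_N))` for convergent `x_N`. -/
lemma tendsto_mul_gaussian_tail {x : ℕ → ℝ} {l : ℝ} (hx : Tendsto x atTop (nhds l)) :
    Tendsto (fun N : ℕ => (N : ℝ) *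
      (1 - (gaussianReal 0 1).real (Set.Iic (gumbelCenter N + gumbelScale N * x N)))) atTop
      (nhds (Real.exp (-l))) := by
  set u : ℕ → ℝ := fun N => gumbelCenter N + gumbelScale N * x N with hu
  have hub : Tendsto (fun N => u N * gumbelScale N) atTop (nhds 1) := by
    have := tendsto_gumbelCenter_mul_gumbelScale.add
      ((tendsto_gumbelScale.mul hx).mul tendsto_gumbelScale)
    simp only [zero_mul, add_zero, mul_zero] at this
    exact this.congr fun N => by simp only [hu]; ring
  have hutop : Tendsto u atTop atTop := by
    have h1 : Tendsto (fun N => 1 / gumbelScale N) atTop atTop := by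
      simp_rw [gumbelScale, one_div_one_div]
      exact Real.tendsto_sqrt_atTop.comp (tendsto_log_natCast_atTop.const_mul_atTop two_pos)
    refine (hub.pos_mul_atTop one_pos h1).congr' ?_
    filter_upwards [eventually_ge_atTop 2] with N hN
    have := gumbelScale_pos hN
    field_simp
  have hw : Tendsto (fun N => (gumbelScale N *
      (x N - (Real.log (Real.log N) + Real.log (4 * Real.pi)) / 2)) ^ 2) atTop (nhds 0) := by
    have := ((tendsto_gumbelScale.mul hx).sub
      (tendsto_log_log_mul_gumbelScale.div_const 2)).pow 2
    simp only [zero_mul, zero_div, sub_zero, ne_eq, OfNat.ofNat_ne_zero, not_false_eq_true,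
      zero_pow] at this
    exact this.congr fun N => by ring
  have hlim : Tendsto (fun N => Real.exp (-x N) * (u N * gumbelScale N)⁻¹ *
      Real.exp (-((gumbelScale N *
        (x N - (Real.log (Real.log N) + Real.log (4 * Real.pi)) / 2)) ^ 2 / 2))) atTop
      (nhds (Real.exp (-l))) := by
    have := ((Real.continuous_exp.tendsto _).comp hx.neg).mul (hub.inv₀ one_ne_zero) |>.mul
      ((Real.continuous_exp.tendsto _).comp (hw.div_const 2).neg)
    simpa using this
  have := (tendsto_gaussian_tail_div_atTop.comp hutop).mul hlim
  rw [one_mul] at this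
  refine this.congr' ?_
  filter_upwards [eventually_ge_atTop 2, hutop.eventually_gt_atTop 0] with N hN hu0
  have hL : 0 < Real.log N := Real.log_pos (by exact_mod_cast hN)
  have hN0 : (0 : ℝ) < N := by exact_mod_cast (by omega : 0 < N)
  have hb := gumbelScale_pos hN
  have hbsq : gumbelScale N ^ 2 = 1 / (2 * Real.log N) := by
    rw [gumbelScale, div_pow, Real.sq_sqrt (by positivity), one_pow]
  have hpdf : (N : ℝ) * (gaussianPDFReal 0 1 (u N) / u N) =
      Real.exp (-x N) * (u N * gumbelScale N)⁻¹ *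
      Real.exp (-((gumbelScale N *
        (x N - (Real.log (Real.log N) + Real.log (4 * Real.pi)) / 2)) ^ 2 / 2)) := by
    set c := Real.log (Real.log N) + Real.log (4 * Real.pi) with hc
    have husq : -(u N) ^ 2 / 2 = -Real.log N + (-x N) + c / 2 +
        (-((gumbelScale N * (x N - c / 2)) ^ 2 / 2)) := by
      have h1 : u N = 1 / gumbelScale N + gumbelScale N * (x N - c / 2) := by
        simp only [hu, gumbelCenter, ← hc]; ring
      have h2 : (1 / gumbelScale N) ^ 2 = 2 * Real.log N := by
        rw [div_pow, hbsq]; simp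
      have h3 : 1 / gumbelScale N * gumbelScale N = 1 := by field_simp
      rw [h1]
      linear_combination (-1 / 2 : ℝ) * h2 - (x N - c / 2) * h3
    have hec : Real.exp (c / 2) = √(2 * Real.pi) * (gumbelScale N)⁻¹ := by
      rw [hc, ← Real.log_mul hL.ne' (by positivity), gumbelScale, one_div, inv_inv,
        ← Real.sqrt_mul (by positivity), ← Real.log_sqrt (by positivity),
        Real.exp_log (by positivity)]
      congr 1; ring
    rw [gaussianPDFReal_zero_one, husq, Real.exp_add, Real.exp_add, Real.exp_add, hec,
      Real.exp_neg (Real.log N), Real.exp_log hN0]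
    field_simp
  have hp : 0 < gaussianPDFReal 0 1 (u N) := gaussianPDFReal_pos 0 1 _ one_ne_zero
  rw [← hpdf]
  simp only [Function.comp]
  field_simp
  rfl

/-- Distribution function of the normalized maximum of `N` independent standard normals. -/
noncomputable def iidMaxCDF (N : ℕ) (x : ℝ) : ℝ :=
  (gaussianReal 0 1).real (Set.Iic (gumbelCenter N + gumbelScale N * x)) ^ N

lemma iidMaxCDF_nonneg (N : ℕ) (x : ℝ) : 0 ≤ iidMaxCDF N x := by
  unfold iidMaxCDF; positivity

lemma iidMaxCDF_le_one (N : ℕ) (x : ℝ) : iidMaxCDF N x ≤ 1 :=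
  pow_le_one₀ measureReal_nonneg measureReal_le_one

lemma iidMaxCDF_mono {N : ℕ} (hN : 2 ≤ N) : Monotone (iidMaxCDF N) := by
  intro x y hxy
  have := (gumbelScale_pos hN).le
  refine pow_le_pow_left₀ measureReal_nonneg (measureReal_mono (Set.Iic_subset_Iic.2 ?_)) _
  gcongr

lemma tendsto_iidMaxCDF {x : ℕ → ℝ} {l : ℝ} (hx : Tendsto x atTop (nhds l)) :
    Tendsto (fun N => iidMaxCDF N (x N)) atTop (nhds (Real.exp (-Real.exp (-l)))) := by
  have h := Real.tendsto_one_add_pow_exp_of_tendsto (g := fun N : ℕ =>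
    -(1 - (gaussianReal 0 1).real (Set.Iic (gumbelCenter N + gumbelScale N * x N))))
    (t := -Real.exp (-l)) ((tendsto_mul_gaussian_tail hx).neg.congr fun N => by ring)
  refine h.congr fun N => ?_
  rw [iidMaxCDF]
  congr 1; ring

lemma tendsto_iidMaxCDF_atTop {x : ℕ → ℝ} (hx : Tendsto x atTop atTop) :
    Tendsto (fun N => iidMaxCDF N (x N)) atTop (nhds 1) := by
  have hlim : Tendsto (fun K : ℝ => Real.exp (-Real.exp (-K))) atTop (nhds 1) := by
    have := (Real.continuous_exp.tendsto _).comp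
      (Real.tendsto_exp_atBot.comp tendsto_neg_atTop_atBot).neg
    simpa [Function.comp_def] using this
  refine tendsto_order.2 ⟨fun c hc => ?_, fun c hc =>
    Eventually.of_forall fun N => (iidMaxCDF_le_one N _).trans_lt hc⟩
  obtain ⟨K, hK⟩ := (hlim.eventually_const_lt hc).exists
  filter_upwards [(tendsto_iidMaxCDF (tendsto_const_nhds (x := K))).eventually_const_lt hK,
    hx.eventually_ge_atTop K, eventually_ge_atTop 2] with N h1 h2 h3
  exact h1.trans_le (iidMaxCDF_mono h3 h2)

lemma tendsto_iidMaxCDF_atBot {x : ℕ → ℝ} (hx : Tendsto x atTop atBot) :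
    Tendsto (fun N => iidMaxCDF N (x N)) atTop (nhds 0) := by
  have hlim : Tendsto (fun K : ℝ => Real.exp (-Real.exp (-K))) atBot (nhds 0) :=
    Real.tendsto_exp_atBot.comp (tendsto_neg_atTop_atBot.comp
      (Real.tendsto_exp_atTop.comp tendsto_neg_atBot_atTop))
  refine tendsto_order.2 ⟨fun c hc =>
    Eventually.of_forall fun N => hc.trans_le (iidMaxCDF_nonneg N _), fun c hc => ?_⟩
  obtain ⟨K, hK⟩ := (hlim.eventually_lt_const hc).exists
  filter_upwards [(tendsto_iidMaxCDF (tendsto_const_nhds (x := K))).eventually_lt_const hK,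
    hx.eventually_le_atBot K, eventually_ge_atTop 2] with N h1 h2 h3
  exact (iidMaxCDF_mono h3 h2).trans_lt h1

/-- Conditional distribution function, given the common factor `v`, of the maximum of `N` standard
normals with pairwise correlation `r`. -/
noncomputable def conditionalMaxCDF (r : ℝ) (N : ℕ) (t v : ℝ) : ℝ :=
  (gaussianReal 0 1).real {x | √r * v + √(1 - r) * x ≤ t} ^ N

lemma conditionalMaxCDF_nonneg (r : ℝ) (N : ℕ) (t v : ℝ) : 0 ≤ conditionalMaxCDF r N t v :=
  pow_nonneg measureReal_nonneg _

lemma conditionalMaxCDF_le_one (r : ℝ) (N : ℕ) (t v : ℝ) : conditionalMaxCDF r N t v ≤ 1 :=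
  pow_le_one₀ measureReal_nonneg measureReal_le_one

lemma norm_conditionalMaxCDF_le_one (r : ℝ) (N : ℕ) (t v : ℝ) :
    ‖conditionalMaxCDF r N t v‖ ≤ 1 := by
  rw [Real.norm_of_nonneg (conditionalMaxCDF_nonneg _ _ _ _)]
  exact conditionalMaxCDF_le_one _ _ _ _

lemma measurable_conditionalMaxCDF (r : ℝ) (N : ℕ) (t : ℝ) :
    Measurable (conditionalMaxCDF r N t) := by
  refine Antitone.measurable fun v w hvw => ?_
  refine pow_le_pow_left₀ measureReal_nonneg (measureReal_mono fun x hx => ?_) _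
  have h1 : √r * v ≤ √r * w := by gcongr
  have h2 : √r * w + √(1 - r) * x ≤ t := hx
  change √r * v + √(1 - r) * x ≤ t
  linarith

lemma tendsto_sqrt_div_gumbelScale {r : ℕ → ℝ} (hr : ∀ N, 0 ≤ r N) {τ : ℝ}
    (h : Tendsto (fun N : ℕ => r N * Real.log N) atTop (nhds τ)) :
    Tendsto (fun N => √(r N) / gumbelScale N) atTop (nhds √(2 * τ)) := by
  refine ((h.const_mul 2).sqrt).congr fun N => ?_
  rw [gumbelScale, div_div_eq_mul_div, div_one, ← Real.sqrt_mul (hr N)]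
  congr 1; ring

lemma tendsto_sqrt_div_gumbelScale_atTop {r : ℕ → ℝ} (hr : ∀ N, 0 ≤ r N)
    (h : Tendsto (fun N : ℕ => r N * Real.log N) atTop atTop) :
    Tendsto (fun N => √(r N) / gumbelScale N) atTop atTop := by
  refine (Real.tendsto_sqrt_atTop.comp (h.const_mul_atTop two_pos)).congr fun N => ?_
  rw [gumbelScale, div_div_eq_mul_div, div_one, ← Real.sqrt_mul (hr N)]
  simp only [Function.comp]
  congr 1; ring

lemma tendsto_conditionalMaxCDF {r : ℕ → ℝ} (hr : ∀ N, 0 ≤ r N) {τ : ℝ}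
    (h : Tendsto (fun N : ℕ => r N * Real.log N) atTop (nhds τ)) (z v : ℝ) :
    Tendsto (fun N => conditionalMaxCDF (r N) N (gumbelCenter N + gumbelScale N * z) v) atTop
      (nhds (Real.exp (-Real.exp (-(z + τ - √(2 * τ) * v))))) := by
  have hr0 : Tendsto r atTop (nhds 0) := by
    refine (h.div_atTop tendsto_log_natCast_atTop).congr' ?_
    filter_upwards [eventually_ge_atTop 2] with N hN
    have hL : 0 < Real.log N := Real.log_pos (by exact_mod_cast hN)
    field_simp
  have hq : Tendsto (fun N => √(1 - r N)) atTop (nhds 1) := by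
    simpa using (hr0.const_sub 1).sqrt
  have hab : Tendsto (fun N => gumbelCenter N / gumbelScale N * r N) atTop (nhds (2 * τ)) := by
    have := tendsto_gumbelCenter_mul_gumbelScale.mul (h.const_mul 2)
    rw [one_mul] at this
    refine this.congr' ?_
    filter_upwards [eventually_ge_atTop 2] with N hN
    have hL : 0 < Real.log N := Real.log_pos (by exact_mod_cast hN)
    have hb := gumbelScale_pos hN
    have hbsq : gumbelScale N ^ 2 * (2 * Real.log N) = 1 := by
      rw [gumbelScale, div_pow, Real.sq_sqrt (by positivity), one_pow]
      field_simp
    field_simp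
    linear_combination (gumbelCenter N * r N) * hbsq
  have hx : Tendsto (fun N => (z - √(r N) / gumbelScale N * v) / √(1 - r N) +
      gumbelCenter N / gumbelScale N * r N / (√(1 - r N) * (1 + √(1 - r N)))) atTop
      (nhds (z + τ - √(2 * τ) * v)) := by
    have h1 := (((tendsto_sqrt_div_gumbelScale hr h).mul_const v).const_sub z).div hq one_ne_zero
    have h2 := hab.div (hq.mul (hq.const_add 1)) (by norm_num)
    have e : z + τ - √(2 * τ) * v =
        (z - √(2 * τ) * v) / 1 + 2 * τ / (1 * (1 + 1)) := by ring
    rw [e]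
    exact h1.add h2
  refine (tendsto_iidMaxCDF hx).congr' ?_
  filter_upwards [eventually_ge_atTop 2, hr0.eventually_lt_const one_pos] with N hN hr1
  have hb := gumbelScale_pos hN
  have hq0 : 0 < √(1 - r N) := Real.sqrt_pos.2 (by linarith)
  have hq2 : √(1 - r N) ^ 2 = 1 - r N := Real.sq_sqrt (by linarith)
  rw [iidMaxCDF, conditionalMaxCDF]
  congr 2
  ext x
  simp only [Set.mem_Iic, Set.mem_ofPred_eq]
  have e : gumbelCenter N + gumbelScale N * ((z - √(r N) / gumbelScale N * v) / √(1 - r N) +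
      gumbelCenter N / gumbelScale N * r N / (√(1 - r N) * (1 + √(1 - r N)))) =
      (gumbelCenter N + gumbelScale N * z - √(r N) * v) / √(1 - r N) := by
    field_simp
    linear_combination gumbelCenter N * hq2
  rw [e, le_div_iff₀ hq0, le_sub_iff_add_le', mul_comm x]

lemma tendsto_integral_conditionalMaxCDF {r : ℕ → ℝ} (hr : ∀ N, 0 ≤ r N) {τ : ℝ}
    (h : Tendsto (fun N : ℕ => r N * Real.log N) atTop (nhds τ)) (z : ℝ) :
    Tendsto (fun N => ∫ v, conditionalMaxCDF (r N) N (gumbelCenter N + gumbelScale N * z) v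
      ∂(gaussianReal 0 1)) atTop
      (nhds (∫ v, Real.exp (-Real.exp (-(z + τ - √(2 * τ) * v))) ∂(gaussianReal 0 1))) :=
  tendsto_integral_of_dominated_convergence (fun _ => 1)
    (fun _ => (measurable_conditionalMaxCDF _ _ _).aestronglyMeasurable) (integrable_const 1)
    (fun _ => ae_of_all _ fun _ => norm_conditionalMaxCDF_le_one _ _ _ _)
    (ae_of_all _ fun v => tendsto_conditionalMaxCDF hr h z v)

lemma integral_gumbel_comp_mul_gaussianReal {τ : ℝ} (hτ : 0 < τ) (z : ℝ) :
    ∫ v, Real.exp (-Real.exp (-(z + τ - √(2 * τ) * v))) ∂(gaussianReal 0 1) =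
      ∫ u : ℝ, Real.exp (-Real.exp (-((z - u) + τ))) *
        (Real.exp (-u ^ 2 / (4 * τ)) / √(4 * Real.pi * τ)) := by
  have hmap : (gaussianReal 0 1).map (fun v => √(2 * τ) * v) =
      gaussianReal 0 (Real.toNNReal (2 * τ)) := by
    rw [gaussianReal_map_const_mul, mul_zero, mul_one]
    congr 1
    ext
    rw [Real.coe_toNNReal _ (by positivity)]
    exact Real.sq_sqrt (by positivity)
  have hne : Real.toNNReal (2 * τ) ≠ 0 := by
    rw [ne_eq, Real.toNNReal_eq_zero]; linarith
  have e1 : ∫ v, Real.exp (-Real.exp (-(z + τ - √(2 * τ) * v))) ∂(gaussianReal 0 1) =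
      ∫ u, Real.exp (-Real.exp (-(z + τ - u))) ∂(gaussianReal 0 (Real.toNNReal (2 * τ))) := by
    rw [← hmap, integral_map (by fun_prop) (by fun_prop)]
  rw [e1, integral_gaussianReal_eq_integral_smul hne]
  congr 1 with u
  rw [gaussianPDFReal, Real.coe_toNNReal _ (by positivity), smul_eq_mul, mul_comm]
  congr 1
  · congr 3; ring
  · rw [inv_mul_eq_div, sub_zero]
    have : 2 * Real.pi * (2 * τ) = 4 * Real.pi * τ := by ring
    rw [this]
    congr 3; ring

lemma tendsto_conditionalMaxCDF_of_tendsto_atTop {r : ℕ → ℝ} (hr : ∀ N, 0 ≤ r N)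
    (hr1 : ∀ᶠ N in atTop, r N ≤ 1)
    (h : Tendsto (fun N : ℕ => r N * Real.log N) atTop atTop) {z v : ℝ} (hv : v ≠ z) :
    Tendsto (fun N => conditionalMaxCDF (r N) N
      (gumbelCenter N * √(1 - r N) + √(r N) * z) v) atTop
      (nhds ((Set.Iic z).indicator 1 v)) := by
  have hs := tendsto_sqrt_div_gumbelScale_atTop hr h
  rcases lt_or_gt_of_ne hv with hlt | hgt
  · rw [Set.indicator_of_mem (Set.mem_Iic.2 hlt.le), Pi.one_apply]
    refine tendsto_of_tendsto_of_tendsto_of_le_of_le'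
      (tendsto_iidMaxCDF_atTop (hs.atTop_mul_const (sub_pos.2 hlt))) tendsto_const_nhds ?_
      (Eventually.of_forall fun N => conditionalMaxCDF_le_one _ _ _ _)
    filter_upwards [eventually_ge_atTop 2] with N hN
    refine pow_le_pow_left₀ measureReal_nonneg (measureReal_mono fun x hx => ?_) _
    have hb := gumbelScale_pos hN
    have e : gumbelScale N * (√(r N) / gumbelScale N * (z - v)) = √(r N) * (z - v) := by
      field_simp
    have hx' : x - gumbelCenter N ≤ √(r N) * (z - v) := by
      have := Set.mem_Iic.1 hx
      rw [e] at this
      linarith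
    have hq0 : 0 ≤ √(1 - r N) := Real.sqrt_nonneg _
    have hq1 : √(1 - r N) ≤ 1 := Real.sqrt_le_one.2 (by linarith [hr N])
    have h1 := mul_le_mul_of_nonneg_left hx' hq0
    have h2 : 0 ≤ √(r N) * (z - v) := mul_nonneg (Real.sqrt_nonneg _) (by linarith)
    have h3 := mul_le_of_le_one_left h2 hq1
    change √(r N) * v + √(1 - r N) * x ≤ gumbelCenter N * √(1 - r N) + √(r N) * z
    linarith
  · rw [Set.indicator_of_notMem (by simpa using hgt)]
    refine tendsto_of_tendsto_of_tendsto_of_le_of_le' tendsto_const_nhds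
      (tendsto_iidMaxCDF_atBot (hs.atTop_mul_const_of_neg (sub_neg.2 hgt)))
      (Eventually.of_forall fun N => conditionalMaxCDF_nonneg _ _ _ _) ?_
    filter_upwards [eventually_ge_atTop 2, hs.eventually_gt_atTop 0, hr1] with N hN hs0 hr1
    refine pow_le_pow_left₀ measureReal_nonneg (measureReal_mono fun x hx => ?_) _
    have hb := gumbelScale_pos hN
    have e : gumbelScale N * (√(r N) / gumbelScale N * (z - v)) = √(r N) * (z - v) := by
      field_simp
    have hr0 : 0 < √(r N) := (div_pos_iff_of_pos_right hb).1 hs0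
    have hq0 : 0 ≤ √(1 - r N) := Real.sqrt_nonneg _
    have hq1 : √(1 - r N) ≤ 1 := Real.sqrt_le_one.2 (by linarith [hr N])
    have hx' : √(r N) * v + √(1 - r N) * x ≤ gumbelCenter N * √(1 - r N) + √(r N) * z := hx
    have h2 : 0 < √(r N) * (v - z) := mul_pos hr0 (by linarith)
    have h3 : √(1 - r N) * (x - gumbelCenter N) < 0 := by linarith
    have h4 : x - gumbelCenter N < 0 := by
      by_contra! hc
      linarith [mul_nonneg hq0 hc]
    have h5 : 0 ≤ (1 - √(1 - r N)) * (gumbelCenter N - x) :=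
      mul_nonneg (by linarith) (by linarith)
    rw [e, Set.mem_Iic]
    linarith

lemma tendsto_integral_conditionalMaxCDF_of_tendsto_atTop {r : ℕ → ℝ} (hr : ∀ N, 0 ≤ r N)
    (hr1 : ∀ᶠ N in atTop, r N ≤ 1)
    (h : Tendsto (fun N : ℕ => r N * Real.log N) atTop atTop) (z : ℝ) :
    Tendsto (fun N => ∫ v, conditionalMaxCDF (r N) N
      (gumbelCenter N * √(1 - r N) + √(r N) * z) v ∂(gaussianReal 0 1)) atTop
      (nhds (∫ x in Set.Iic z, Real.exp (-x ^ 2 / 2) / √(2 * Real.pi))) := by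
  have e : ∫ x in Set.Iic z, Real.exp (-x ^ 2 / 2) / √(2 * Real.pi) =
      ∫ v, (Set.Iic z).indicator 1 v ∂(gaussianReal 0 1) := by
    rw [integral_indicator_one measurableSet_Iic, measureReal_def,
      gaussianReal_apply_eq_integral 0 one_ne_zero, ENNReal.toReal_ofReal
      (integral_nonneg fun t => gaussianPDFReal_nonneg 0 1 t)]
    simp_rw [gaussianPDFReal_zero_one, inv_mul_eq_div]
  rw [e]
  have : NullSingletonClass (gaussianReal 0 1) := nullSingletonClass_gaussianReal one_ne_zero
  refine tendsto_integral_of_dominated_convergence (fun _ => 1)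
    (fun _ => (measurable_conditionalMaxCDF _ _ _).aestronglyMeasurable) (integrable_const 1)
    (fun _ => ae_of_all _ fun _ => norm_conditionalMaxCDF_le_one _ _ _ _) ?_
  filter_upwards [(Set.countable_singleton z).ae_notMem (gaussianReal 0 1)] with v hv
  exact tendsto_conditionalMaxCDF_of_tendsto_atTop hr hr1 h hv

/-- Distribution function of an affinely normalized maximum of a constantly correlated Gaussian
vector, as a mixture over the common factor. -/
lemma measure_iSup_sub_div_le_eq_integral {Ω : Type*} [MeasurableSpace Ω] (μ : Measure Ω)
    [IsProbabilityMeasure μ] {Y : ℕ → Ω → ℝ} (hY : ∀ i, Measurable (Y i)) {r : ℝ} (h0 : 0 ≤ r)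
    {N : ℕ} (hN : 2 ≤ N)
    (hgauss : ∀ c : ℕ → ℝ,
      Measure.map (fun ω => ∑ i ∈ Finset.range N, c i * Y i ω) μ =
        gaussianReal 0
          (Real.toNNReal (∑ i ∈ Finset.range N, ∑ j ∈ Finset.range N,
            c i * c j * (if i = j then 1 else r)))) (m z : ℝ) {s : ℝ} (hs : 0 < s) :
    (μ {ω | ((⨆ i : Fin N, Y i ω) - m) / s ≤ z}).toReal =
      ∫ v, conditionalMaxCDF r N (m + s * z) v ∂(gaussianReal 0 1) := by
  have h1 := le_one_of_map_eq_gaussianReal μ hY hN hgauss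
  have : Nonempty (Fin N) := ⟨⟨0, by omega⟩⟩
  have hset : {ω | ((⨆ i : Fin N, Y i ω) - m) / s ≤ z} =
      {ω | ∀ i : Fin N, Y i ω ≤ m + s * z} := by
    ext ω
    simp only [Set.mem_ofPred_eq]
    rw [div_le_iff₀ hs, sub_le_iff_le_add, ciSup_le_iff (Set.finite_range _).bddAbove,
      mul_comm, add_comm]
  rw [hset]
  have hfin : ∀ c : Fin N → ℝ, μ.map (fun ω => ∑ i, c i * Y i ω) =
      gaussianReal 0 (Real.toNNReal (∑ i, ∑ j, c i * c j * (if i = j then 1 else r))) := by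
    intro c
    have := hgauss fun i => if h : i < N then c ⟨i, h⟩ else 0
    simpa [Finset.sum_range, Fin.val_inj] using this
  have := measureReal_forall_le_eq_integral μ (fun i : Fin N => hY i) h0 h1 hfin (m + s * z)
  simpa [conditionalMaxCDF, measureReal_def] using this

/-- **Extreme values of constantly correlated Gaussian vectors.**  For each `N`, let
`(x_1,…,x_N)` be a centered Gaussian vector with unit variances and constant pairwise
correlation `r_N ≥ 0`, and `y_N = max(x_1,…,x_N)`.  With `b_N = (2 ln N)^{−1/2}` and
`a_N = 1/b_N − (b_N/2)(ln ln N + ln 4π)`: if `r_N ln N → 0`, then `(y_N−a_N)/b_N` tends in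
distribution to the Gumbel law; if `r_N ln N → τ > 0`, it tends to the convolution of the
translated Gumbel density `exp(−(z+τ)−e^{−(z+τ)})` with the centered Gaussian of variance
`2τ`; if `r_N ln N → ∞`, then `(y_N − a_N√(1−r_N))/√(r_N)` tends to the standard normal
law.  Joint Gaussianity is encoded through linear combinations. -/
theorem evs_constant_correlation_gaussian
    {Ω : Type*} [MeasurableSpace Ω] (μ : Measure Ω) [IsProbabilityMeasure μ]
    (X : ℕ → ℕ → Ω → ℝ) (hmeas : ∀ N i, Measurable (X N i))
    (r : ℕ → ℝ) (hr : ∀ N, 0 ≤ r N)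
    (hgauss : ∀ (N : ℕ) (c : ℕ → ℝ),
      Measure.map (fun ω => ∑ i ∈ Finset.range N, c i * X N i ω) μ =
        gaussianReal 0
          (Real.toNNReal (∑ i ∈ Finset.range N, ∑ j ∈ Finset.range N,
            c i * c j * (if i = j then 1 else r N))))
    (b a : ℕ → ℝ)
    (hbdef : ∀ N, b N = 1 / Real.sqrt (2 * Real.log N))
    (hadef : ∀ N, a N = 1 / b N - (b N / 2) * (Real.log (Real.log N) + Real.log (4 * Real.pi))) :
    ((Tendsto (fun N : ℕ => r N * Real.log N) atTop (nhds 0) →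
        ∀ z : ℝ,
          Tendsto (fun N : ℕ =>
              (μ {ω | ((⨆ i : Fin N, X N i ω) - a N) / b N ≤ z}).toReal)
            atTop (nhds (Real.exp (-Real.exp (-z)))))
    ∧ (∀ τ : ℝ, 0 < τ → Tendsto (fun N : ℕ => r N * Real.log N) atTop (nhds τ) →
        ∀ z : ℝ,
          Tendsto (fun N : ℕ =>
              (μ {ω | ((⨆ i : Fin N, X N i ω) - a N) / b N ≤ z}).toReal)
            atTop (nhds (∫ u : ℝ, Real.exp (-Real.exp (-((z - u) + τ))) *
              (Real.exp (-u ^ 2 / (4 * τ)) / Real.sqrt (4 * Real.pi * τ)))))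
    ∧ (Tendsto (fun N : ℕ => r N * Real.log N) atTop atTop →
        ∀ z : ℝ,
          Tendsto (fun N : ℕ =>
              (μ {ω | ((⨆ i : Fin N, X N i ω) - a N * Real.sqrt (1 - r N)) /
                  Real.sqrt (r N) ≤ z}).toReal)
            atTop (nhds (∫ x in Set.Iic z, Real.exp (-x ^ 2 / 2) / Real.sqrt (2 * Real.pi))))) := by
  obtain rfl : b = gumbelScale := funext hbdef
  obtain rfl : a = gumbelCenter := funext hadef
  have hlaw : ∀ τ : ℝ, Tendsto (fun N : ℕ => r N * Real.log N) atTop (nhds τ) → ∀ z : ℝ,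
      Tendsto (fun N : ℕ =>
        (μ {ω | ((⨆ i : Fin N, X N i ω) - gumbelCenter N) / gumbelScale N ≤ z}).toReal) atTop
      (nhds (∫ v, Real.exp (-Real.exp (-(z + τ - √(2 * τ) * v))) ∂(gaussianReal 0 1))) := by
    intro τ h z
    refine (tendsto_integral_conditionalMaxCDF hr h z).congr' ?_
    filter_upwards [eventually_ge_atTop 2] with N hN
    exact (measure_iSup_sub_div_le_eq_integral μ (hmeas N) (hr N) hN (hgauss N) _ z
      (gumbelScale_pos hN)).symm
  refine ⟨fun h z => by simpa using hlaw 0 h z, fun τ hτ h z => ?_, fun h z => ?_⟩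
  · rw [← integral_gumbel_comp_mul_gaussianReal hτ]
    exact hlaw τ h z
  · have hr1 : ∀ᶠ N in atTop, r N ≤ 1 := by
      filter_upwards [eventually_ge_atTop 2] with N hN
      exact le_one_of_map_eq_gaussianReal μ (hmeas N) hN (hgauss N)
    refine (tendsto_integral_conditionalMaxCDF_of_tendsto_atTop hr hr1 h z).congr' ?_
    filter_upwards [eventually_ge_atTop 2, h.eventually_gt_atTop 0] with N hN hpos
    have hr0 : 0 < r N := (hr N).lt_of_ne fun h0 => by simp [← h0] at hpos
    exact (measure_iSup_sub_div_le_eq_integral μ (hmeas N) (hr N) hN (hgauss N) _ z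
      (Real.sqrt_pos.2 hr0)).symm
end

section
/- Let p be a probability density on (0,∞), F̃(z) = ∫_z^∞ p(y) dy, Ω a nonnegative function on (0,1], and Z_N > 0 a normalization constant. Define on (0,∞)^N the joint density Ψ_{a,N}(u_1,...,u_N) = (1/Z_N) · Ω[F̃(Σ_{n=1}^N u_n)] · Π_{n=1}^N p(Σ_{i=n}^N u_i), and let J(z_1,...,z_N) = Ψ_{a,N}(z_1−z_2, z_2−z_3, ..., z_{N−1}−z_N, z_N) be the joint density of the partial sums z_i = Σ_{j=i}^N u_j. Then the symmetrized density J_sym(z_1,...,z_N) = Σ_{permutations σ} J(z_{σ(1)},...,z_{σ(N)}) · Π_{i=1}^{N−1} Θ(z_{σ(i)} − z_{σ(i+1)}) satisfies, for every tuple of pairwise distinct positive numbers z_1,...,z_N, the identity J_sym(z_1,...,z_N) = (1/Z_N) · (Π_{i=1}^N p(z_i)) · Ω[F̃(max(z_1,...,z_N))]. -/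
open MeasureTheory Filter

/-- The joint density `Ψ_{a,N}(u_1,…,u_N) = (1/Z)·Ω[F̃(∑ u_n)]·∏_n p(∑_{i=n}^N u_i)`,
where `F̃(z) = ∫_z^∞ p`. -/
noncomputable def PsiDist (N : ℕ) (p Om : ℝ → ℝ) (Z : ℝ) (u : Fin N → ℝ) : ℝ :=
  (1 / Z) * Om (∫ y in Set.Ioi (∑ i, u i), p y) *
    ∏ n : Fin N, p (∑ i : Fin N, if n ≤ i then u i else 0)

/-- The density `J(z_1,…,z_N) = Ψ_{a,N}(z_1−z_2, …, z_{N−1}−z_N, z_N)` of the partial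
sums `z_i = ∑_{j=i}^N u_j`. -/
noncomputable def Jdens (N : ℕ) (p Om : ℝ → ℝ) (Z : ℝ) (z : Fin N → ℝ) : ℝ :=
  PsiDist N p Om Z
    (fun i => if h : (i : ℕ) + 1 < N then z i - z ⟨(i : ℕ) + 1, h⟩ else z i)

/-- The Heaviside step function: `Θ(t) = 1` for `t > 0` and `0` for `t ≤ 0`. -/
noncomputable def heaviside (t : ℝ) : ℝ := if 0 < t then 1 else 0

/-- The symmetrized density
`J_sym(z_1,…,z_N) = ∑_σ J(z_{σ(1)},…,z_{σ(N)})·∏_{i=1}^{N−1} Θ(z_{σ(i)} − z_{σ(i+1)})`. -/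
noncomputable def Jsym (N : ℕ) (p Om : ℝ → ℝ) (Z : ℝ) (z : Fin N → ℝ) : ℝ :=
  ∑ σ : Equiv.Perm (Fin N),
    Jdens N p Om Z (z ∘ σ) *
      ∏ i : Fin N,
        (if h : (i : ℕ) + 1 < N then heaviside (z (σ i) - z (σ ⟨(i : ℕ) + 1, h⟩)) else 1)

/-- The tail sums of the increments of `w` telescope back to `w`. -/
lemma sum_tail_increments (N : ℕ) (w : Fin N → ℝ) (n : Fin N) :
    (∑ i : Fin N, if n ≤ i then
      (if h : (i : ℕ) + 1 < N then w i - w ⟨(i : ℕ) + 1, h⟩ else w i) else 0) = w n := by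
  set f : ℕ → ℝ := fun k => if h : k < N then w ⟨k, h⟩ else 0 with hf
  have hterm (i : Fin N) : (if n ≤ i then
      (if h : (i : ℕ) + 1 < N then w i - w ⟨(i : ℕ) + 1, h⟩ else w i) else 0) =
      if (n : ℕ) ≤ (i : ℕ) then f i - f (i + 1) else 0 := by
    simp only [hf, Fin.le_def, i.isLt, dite_true]
    split_ifs <;> simp
  rw [Finset.sum_congr rfl fun i _ => hterm i,
    Fin.sum_univ_eq_sum_range (fun k => if (n : ℕ) ≤ k then f k - f (k + 1) else 0) N,
    ← Finset.sum_filter]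
  have hset : (Finset.range N).filter (fun k => (n : ℕ) ≤ k) = Finset.Ico (n : ℕ) N := by
    ext k
    simp [and_comm]
  rw [hset, Finset.sum_Ico_eq_sum_range]
  have htel := Finset.sum_range_sub' (fun k => f (n + k)) (N - n)
  simp only [add_assoc] at htel ⊢
  rw [htel, Nat.add_sub_cancel' n.isLt.le]
  simp [hf]

/-- In the partial-sum coordinates the density factorizes. -/
lemma Jdens_succ (m : ℕ) (p Om : ℝ → ℝ) (Z : ℝ) (w : Fin (m + 1) → ℝ) :
    Jdens (m + 1) p Om Z w =
      (1 / Z) * Om (∫ y in Set.Ioi (w 0), p y) * ∏ n, p (w n) := by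
  have h0 := sum_tail_increments (m + 1) w 0
  simp only [Fin.zero_le, if_true] at h0
  unfold Jdens PsiDist
  rw [h0]
  simp only [sum_tail_increments]

/-- The product of Heaviside factors is the indicator of strictly decreasing tuples. -/
lemma prod_heaviside_eq_ite (m : ℕ) (w : Fin (m + 1) → ℝ) [Decidable (StrictAnti w)] :
    (∏ i : Fin (m + 1), (if h : (i : ℕ) + 1 < m + 1 then
      heaviside (w i - w ⟨(i : ℕ) + 1, h⟩) else 1)) = if StrictAnti w then 1 else 0 := by
  have hprod : (∏ i : Fin (m + 1), (if h : (i : ℕ) + 1 < m + 1 then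
      heaviside (w i - w ⟨(i : ℕ) + 1, h⟩) else 1)) =
      ∏ i : Fin m, heaviside (w i.castSucc - w i.succ) := by
    rw [Fin.prod_univ_castSucc]
    simp [Fin.succ]
  rw [hprod]
  split_ifs with h
  · refine Finset.prod_eq_one fun i _ => ?_
    simp [heaviside, h i.castSucc_lt_succ]
  · rw [Fin.strictAnti_iff_succ_lt] at h
    push Not at h
    obtain ⟨i, hi⟩ := h
    refine Finset.prod_eq_zero (Finset.mem_univ i) ?_
    simp [heaviside, hi]

/-- Exactly one permutation arranges pairwise distinct values in decreasing order. -/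
lemma existsUnique_perm_strictAnti {N : ℕ} {z : Fin N → ℝ} (hz : Function.Injective z) :
    ∃! σ : Equiv.Perm (Fin N), StrictAnti (z ∘ σ) := by
  have hmono := Tuple.monotone_sort (fun i => -z i)
  refine ⟨Tuple.sort fun i => -z i, ?_, fun τ hτ => ?_⟩
  · refine Antitone.strictAnti_of_injective (fun i j hij => ?_) (hz.comp (Equiv.injective _))
    exact neg_le_neg_iff.mp (hmono hij)
  · have hτ' : Monotone ((fun i => -z i) ∘ τ) := fun i j hij => neg_le_neg (hτ.antitone hij)
    have h := Tuple.unique_monotone hτ' hmono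
    ext i : 1
    exact hz (neg_injective (congrFun h i))

/-- The first entry of a decreasing rearrangement is the maximum. -/
lemma iSup_eq_apply_zero_of_antitone {m : ℕ} {z : Fin (m + 1) → ℝ}
    {σ : Equiv.Perm (Fin (m + 1))} (hσ : Antitone (z ∘ σ)) : ⨆ i, z i = z (σ 0) := by
  refine le_antisymm (ciSup_le fun i => ?_) (le_ciSup (Set.finite_range z).bddAbove (σ 0))
  simpa using hσ (Fin.zero_le (σ.symm i))

/-- **From sums back to extreme values.**  For every tuple of pairwise distinct positive
reals `z_1,…,z_N`, the symmetrized density of the partial sums of `Ψ_{a,N}` satisfies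
`J_sym(z_1,…,z_N) = (1/Z)·(∏_i p(z_i))·Ω[F̃(max(z_1,…,z_N))]`. -/
theorem jsym_eq_max_density
    (N : ℕ) (hN : 1 ≤ N) (p Om : ℝ → ℝ) (Z : ℝ) (hZ : 0 < Z)
    (z : Fin N → ℝ) (hzpos : ∀ i, 0 < z i) (hzdist : Function.Injective z) :
    Jsym N p Om Z z =
      (1 / Z) * (∏ i, p (z i)) * Om (∫ y in Set.Ioi (⨆ i, z i), p y) := by
  classical
  obtain ⟨m, rfl⟩ := Nat.exists_eq_add_of_le' hN
  obtain ⟨σ, hσ, huniq⟩ := existsUnique_perm_strictAnti hzdist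
  have hterm (τ : Equiv.Perm (Fin (m + 1))) := prod_heaviside_eq_ite m (z ∘ τ)
  simp only [Function.comp_apply] at hterm
  unfold Jsym
  simp only [hterm]
  rw [Finset.sum_eq_single σ (fun τ _ hτ => ?_) (by simp), if_pos hσ, Jdens_succ,
    iSup_eq_apply_zero_of_antitone hσ.antitone]
  · simp only [Function.comp_apply]
    rw [Equiv.prod_comp σ fun i => p (z i)]
    ring
  · rw [if_neg fun h => hτ (huniq τ h), mul_zero]
end
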